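/- arXiv:1711.11187 — 3 statements merged into one kernel-verified Lean document; each statement's English description precedes it below -/
import Mathlib

section
/- Let N ≥ 1 and let a be a real number with −1 < a < 1 and aN < 2. Let p satisfy 1 < p ≤ 1 + (2−a)/N. Let Γ : ℝ^N × ℝ^N × (0,∞) → ℝ be a measurable kernel which is positive, satisfies (K1) and (K2), and satisfies the lower Gaussian-type bound: there exist c₁, c₂ > 0 such that Γ(x,y,t) ≥ c₁ t^{−N/(2−a)} exp(−c₂ (|x−y|^{(2−a)}/t)^{1/(1−a)}) for all x, y ∈ ℝ^N and t > 0 with |y₁| ≤ t^{1/(2−a)}, where y₁ denotes the first coordinate of y. Then there is no nontrivial global-in-time mild solution: if φ is a nonnegative measurable function on ℝ^N and u is a mild solution of u_t = div(w∇u) + u^p with kernel Γ and initial data φ on ℝ^N × (0,∞), then u = 0 almost everywhere on ℝ^N × (0,∞). -/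
open MeasureTheory Real Set
open scoped ENNReal

noncomputable section

/-- `N`-dimensional Euclidean space. -/
abbrev E (N : ℕ) : Type := EuclideanSpace ℝ (Fin N)

/-- A mild solution of `u_t = div(w ∇u) + u^p` with kernel `Γ` and initial data `φ`
on `ℝ^N × (0,T)` (`T ∈ (0,∞]`): a nonnegative measurable function, essentially bounded
on `ℝ^N × (0,T)`, satisfying the Duhamel integral identity (with all integrals finite). -/
def IsMildSolution (N : ℕ) (p : ℝ) (Γ : E N → E N → ℝ → ℝ)
    (φ : E N → ℝ) (T : ℝ≥0∞) (u : E N → ℝ → ℝ) : Prop :=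
  Measurable (fun q : E N × ℝ => u q.1 q.2) ∧
  (∀ x t, 0 ≤ u x t) ∧
  (∃ M : ℝ, ∀ t : ℝ, 0 < t → ENNReal.ofReal t < T →
    ∀ᵐ x : E N ∂volume, u x t ≤ M) ∧
  (∀ t : ℝ, 0 < t → ENNReal.ofReal t < T →
    ∀ᵐ x : E N ∂volume,
      Integrable (fun y => Γ x y t * φ y) volume ∧
      Integrable (fun q : E N × ℝ => Γ x q.1 (t - q.2) * u q.1 q.2 ^ p)
        (volume.prod (volume.restrict (Ioo (0:ℝ) t))) ∧
      u x t = (∫ y, Γ x y t * φ y) +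
        ∫ s in Ioo (0:ℝ) t, ∫ y, Γ x y (t - s) * u y s ^ p)

/-- The weak `L^r` quasinorm `‖f‖_{r,∞} = sup_{λ>0} λ |{|f|>λ}|^{1/r}`. -/
def weakNorm (N : ℕ) (r : ℝ) (f : E N → ℝ) : ℝ≥0∞ :=
  ⨆ (l : ℝ) (_ : 0 < l), ENNReal.ofReal l * (volume {x : E N | l < |f x|}) ^ (1 / r)

/-- A family of transition densities with respect to `μ` that conserves mass in both variables and
satisfies the Chapman–Kolmogorov identity. -/
structure IsTransitionDensity {X : Type*} [MeasurableSpace X] (μ : Measure X)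
    (k : X → X → ℝ → ℝ≥0∞) : Prop where
  measurable : Measurable fun q : X × X × ℝ => k q.1 q.2.1 q.2.2
  lintegral_fst : ∀ y t, 0 < t → ∫⁻ x, k x y t ∂μ = 1
  lintegral_snd : ∀ x t, 0 < t → ∫⁻ y, k x y t ∂μ = 1
  comp : ∀ x y s t, 0 < s → s < t → k x y t = ∫⁻ ξ, k x ξ (t - s) * k ξ y s ∂μ

/-- A bounded `[0,∞]`-valued solution `v` on `(0,∞)` of the Duhamel identity with kernel `k`,
nonlinearity `v ^ p` and initial data `f`. -/
structure IsDuhamelSolution {X : Type*} [MeasurableSpace X] (μ : Measure X)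
    (k : X → X → ℝ → ℝ≥0∞) (p : ℝ) (f : X → ℝ≥0∞) (v : X → ℝ → ℝ≥0∞) : Prop where
  measurable : Measurable fun q : X × ℝ => v q.1 q.2
  measurable_data : Measurable f
  bounded : ∃ M : ℝ≥0∞, M ≠ ∞ ∧ ∀ t, 0 < t → ∀ᵐ x ∂μ, v x t ≤ M
  duhamel : ∀ t, 0 < t → ∀ᵐ x ∂μ, v x t =
    ∫⁻ y, k x y t * f y ∂μ + ∫⁻ s in Ioo 0 t, ∫⁻ y, k x y (t - s) * v y s ^ p ∂μ

/-- Jensen's inequality for `z ↦ z ^ p` with respect to a probability density. -/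
lemma rpow_lintegral_mul_le {X : Type*} [MeasurableSpace X] {μ : Measure X} {p : ℝ} (hp : 1 ≤ p)
    {k g : X → ℝ≥0∞} (hk : Measurable k) (hg : Measurable g) (hk1 : ∫⁻ y, k y ∂μ = 1) :
    (∫⁻ y, k y * g y ∂μ) ^ p ≤ ∫⁻ y, k y * g y ^ p ∂μ := by
  have hprob : IsProbabilityMeasure (μ.withDensity k) := ⟨by simp [hk1]⟩
  have h := eLpNorm'_le_eLpNorm'_of_exponent_le one_pos hp (μ.withDensity k)
    hg.aestronglyMeasurable
  simp only [eLpNorm', enorm_eq_self, ENNReal.rpow_one, div_one] at h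
  rw [lintegral_withDensity_eq_lintegral_mul _ hk hg,
    lintegral_withDensity_eq_lintegral_mul _ hk (hg.pow_const p)] at h
  have h' := ENNReal.rpow_le_rpow h (by linarith : 0 ≤ p)
  rwa [← ENNReal.rpow_mul, one_div_mul_cancel (by linarith), ENNReal.rpow_one] at h'

namespace IsTransitionDensity

variable {X : Type*} [MeasurableSpace X] {μ : Measure X} {k : X → X → ℝ → ℝ≥0∞}

lemma lintegral_comp [SFinite μ] (hk : IsTransitionDensity μ k) {g : X → ℝ≥0∞} (hg : Measurable g)
    (x : X) {s t : ℝ} (hs : 0 < s) (hst : s < t) :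
    ∫⁻ ξ, k x ξ (t - s) * ∫⁻ y, k ξ y s * g y ∂μ ∂μ = ∫⁻ y, k x y t * g y ∂μ := by
  have hkm := hk.measurable
  have hm (r : ℝ) (z : X) : Measurable fun y => k z y r :=
    hkm.comp (f := fun y => (z, y, r)) (by fun_prop)
  have hm' (r : ℝ) (z : X) : Measurable fun y => k y z r :=
    hkm.comp (f := fun y => (y, z, r)) (by fun_prop)
  have hm2 (r : ℝ) : Measurable fun q : X × X => k q.1 q.2 r :=
    hkm.comp (f := fun q : X × X => (q.1, q.2, r)) (by fun_prop)
  calc ∫⁻ ξ, k x ξ (t - s) * ∫⁻ y, k ξ y s * g y ∂μ ∂μ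
      = ∫⁻ ξ, ∫⁻ y, k x ξ (t - s) * (k ξ y s * g y) ∂μ ∂μ :=
        lintegral_congr fun ξ => (lintegral_const_mul _ ((hm s ξ).mul hg)).symm
    _ = ∫⁻ y, ∫⁻ ξ, k x ξ (t - s) * (k ξ y s * g y) ∂μ ∂μ :=
        lintegral_lintegral_swap (((hm (t - s) x).comp measurable_fst).mul
          ((hm2 s).mul (hg.comp measurable_snd))).aemeasurable
    _ = ∫⁻ y, k x y t * g y ∂μ := by
        refine lintegral_congr fun y => ?_
        simp_rw [← mul_assoc]
        have hmul : Measurable fun ξ => k x ξ (t - s) * k ξ y s := (hm (t - s) x).mul (hm' s y)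
        rw [lintegral_mul_const (g y) hmul, ← hk.comp x y s t hs hst]

end IsTransitionDensity

namespace IsDuhamelSolution

variable {X : Type*} [MeasurableSpace X] {μ : Measure X} {k : X → X → ℝ → ℝ≥0∞} {p : ℝ}
  {f : X → ℝ≥0∞} {v : X → ℝ → ℝ≥0∞}

lemma measurable_slice (hv : IsDuhamelSolution μ k p f v) (t : ℝ) : Measurable fun y => v y t :=
  hv.measurable.comp (f := fun y => (y, t)) (by fun_prop)

/-- Propagating the solution at time `τ` freely up to time `t`. -/
lemma lintegral_propagate [SFinite μ] (hk : IsTransitionDensity μ k)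
    (hv : IsDuhamelSolution μ k p f v) (x : X) {τ t : ℝ} (hτ : 0 < τ) (hτt : τ < t) :
    ∫⁻ y, k x y (t - τ) * v y τ ∂μ =
      ∫⁻ y, k x y t * f y ∂μ + ∫⁻ s in Ioo 0 τ, ∫⁻ y, k x y (t - s) * v y s ^ p ∂μ := by
  have hkm := hk.measurable
  have hvm := hv.measurable
  have hm (r : ℝ) (z : X) : Measurable fun y => k z y r :=
    hkm.comp (f := fun y => (z, y, r)) (by fun_prop)
  have hm2 (r : ℝ) : Measurable fun q : X × X => k q.1 q.2 r :=
    hkm.comp (f := fun q : X × X => (q.1, q.2, r)) (by fun_prop)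
  have hin : Measurable fun q : X × ℝ => ∫⁻ z, k q.1 z (τ - q.2) * v z q.2 ^ p ∂μ := by
    refine Measurable.lintegral_prod_right' (f := fun q : (X × ℝ) × X =>
      k q.1.1 q.2 (τ - q.1.2) * v q.2 q.1.2 ^ p) ?_
    exact (hkm.comp (f := fun q : (X × ℝ) × X => (q.1.1, q.2, τ - q.1.2)) (by fun_prop)).mul
      ((hvm.comp (f := fun q : (X × ℝ) × X => (q.2, q.1.2)) (by fun_prop)).pow_const p)
  have hfree : Measurable fun y => ∫⁻ z, k y z τ * f z ∂μ :=
    Measurable.lintegral_prod_right' (f := fun q : X × X => k q.1 q.2 τ * f q.2)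
      ((hm2 τ).mul (hv.measurable_data.comp measurable_snd))
  calc ∫⁻ y, k x y (t - τ) * v y τ ∂μ
      = ∫⁻ y, (k x y (t - τ) * ∫⁻ z, k y z τ * f z ∂μ + k x y (t - τ) *
          ∫⁻ s in Ioo 0 τ, ∫⁻ z, k y z (τ - s) * v z s ^ p ∂μ) ∂μ := by
        refine lintegral_congr_ae ?_
        filter_upwards [hv.duhamel τ hτ] with y hy
        rw [hy, mul_add]
    _ = ∫⁻ y, k x y (t - τ) * ∫⁻ z, k y z τ * f z ∂μ ∂μ + ∫⁻ y, (k x y (t - τ) *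
          ∫⁻ s in Ioo 0 τ, ∫⁻ z, k y z (τ - s) * v z s ^ p ∂μ) ∂μ :=
        lintegral_add_left ((hm _ x).mul hfree) _
    _ = _ := by
        rw [hk.lintegral_comp hv.measurable_data x hτ hτt]
        congr 1
        calc ∫⁻ y, (k x y (t - τ) * ∫⁻ s in Ioo 0 τ, ∫⁻ z, k y z (τ - s) * v z s ^ p ∂μ) ∂μ
            = ∫⁻ y, (∫⁻ s in Ioo 0 τ,
                k x y (t - τ) * ∫⁻ z, k y z (τ - s) * v z s ^ p ∂μ) ∂μ := by
              refine lintegral_congr fun y => (lintegral_const_mul _ ?_).symm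
              exact hin.comp (f := fun s => (y, s)) (by fun_prop)
          _ = ∫⁻ s in Ioo 0 τ, ∫⁻ y,
                k x y (t - τ) * ∫⁻ z, k y z (τ - s) * v z s ^ p ∂μ ∂μ :=
              lintegral_lintegral_swap
                (((hm _ x).comp measurable_fst).mul hin).aemeasurable
          _ = _ := by
              refine setLIntegral_congr_fun measurableSet_Ioo fun s hs => ?_
              have := hk.lintegral_comp ((hv.measurable_slice s).pow_const p) x
                (sub_pos.2 hs.2) (sub_lt_sub_right hτt s)
              simpa only [sub_sub_sub_cancel_right] using this

lemma lintegral_propagate_le [SFinite μ] (hk : IsTransitionDensity μ k)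
    (hv : IsDuhamelSolution μ k p f v) {τ t : ℝ} (hτ : 0 < τ) (hτt : τ < t) :
    ∀ᵐ x ∂μ, ∫⁻ y, k x y (t - τ) * v y τ ∂μ ≤ v x t := by
  filter_upwards [hv.duhamel t (hτ.trans hτt)] with x hx
  rw [hv.lintegral_propagate hk x hτ hτt, hx]
  gcongr

lemma propagate_add_lintegral_rpow_le [SFinite μ] (hk : IsTransitionDensity μ k)
    (hv : IsDuhamelSolution μ k p f v) (hp : 1 ≤ p) (x : X) {τ s t : ℝ} (hτ : 0 < τ) (hτs : τ < s)
    (hst : s < t) :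
    ∫⁻ y, k x y (t - τ) * v y τ ∂μ +
        ∫⁻ r in Ioo τ s, (∫⁻ y, k x y (t - r) * v y r ∂μ) ^ p ≤
      ∫⁻ y, k x y (t - s) * v y s ∂μ := by
  rw [hv.lintegral_propagate hk x hτ (hτs.trans hst), hv.lintegral_propagate hk x (hτ.trans hτs) hst,
    add_assoc]
  gcongr
  have hsub : Ioo 0 τ ∪ Ioo τ s ⊆ Ioo 0 s :=
    union_subset (Ioo_subset_Ioo_right hτs.le) (Ioo_subset_Ioo_left hτ.le)
  have hdisj : Disjoint (Ioo 0 τ) (Ioo τ s) :=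
    Set.disjoint_left.2 fun r h1 h2 => lt_asymm h1.2 h2.1
  refine le_trans ?_ (lintegral_mono_set hsub)
  rw [lintegral_union measurableSet_Ioo hdisj]
  gcongr 1
  refine setLIntegral_mono' measurableSet_Ioo fun r hr => ?_
  exact rpow_lintegral_mul_le hp
    (hk.measurable.comp (f := fun y => (x, y, t - r)) (by fun_prop)) (hv.measurable_slice r)
    (hk.lintegral_snd x _ (sub_pos.2 (hr.2.trans hst)))

lemma lintegral_rpow_le [SFinite μ] (hk : IsTransitionDensity μ k)
    (hv : IsDuhamelSolution μ k p f v) {t : ℝ} (ht : 0 < t) :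
    ∫⁻ s in Ioo 0 t, ∫⁻ y, v y s ^ p ∂μ ≤ ∫⁻ x, v x t ∂μ := by
  have hkm := hk.measurable
  have hvm := hv.measurable
  have h3 : Measurable fun q : (X × ℝ) × X => k q.1.1 q.2 (t - q.1.2) * v q.2 q.1.2 ^ p :=
    (hkm.comp (f := fun q : (X × ℝ) × X => (q.1.1, q.2, t - q.1.2)) (by fun_prop)).mul
      ((hvm.comp (f := fun q : (X × ℝ) × X => (q.2, q.1.2)) (by fun_prop)).pow_const p)
  calc ∫⁻ s in Ioo 0 t, ∫⁻ y, v y s ^ p ∂μ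
      = ∫⁻ s in Ioo 0 t, ∫⁻ x, ∫⁻ y, k x y (t - s) * v y s ^ p ∂μ ∂μ := by
        refine setLIntegral_congr_fun measurableSet_Ioo fun s hs => ?_
        have hxy : Measurable (Function.uncurry fun x y => k x y (t - s) * v y s ^ p) :=
          h3.comp (f := fun q : X × X => ((q.1, s), q.2)) (by fun_prop)
        have hx (y : X) : Measurable fun x => k x y (t - s) :=
          hkm.comp (f := fun x => (x, y, t - s)) (by fun_prop)
        rw [lintegral_lintegral_swap hxy.aemeasurable]
        refine lintegral_congr fun y => ?_
        rw [lintegral_mul_const _ (hx y), hk.lintegral_fst y _ (sub_pos.2 hs.2), one_mul]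
    _ = ∫⁻ x, (∫⁻ s in Ioo 0 t, ∫⁻ y, k x y (t - s) * v y s ^ p ∂μ) ∂μ :=
        (lintegral_lintegral_swap h3.lintegral_prod_right'.aemeasurable).symm
    _ ≤ ∫⁻ x, v x t ∂μ := by
        refine lintegral_mono_ae ?_
        filter_upwards [hv.duhamel t ht] with x hx
        rw [hx]
        exact le_add_self

end IsDuhamelSolution

/-- The length of the interval of existence of a bounded solution of `w ≥ A + ∫ w ^ p` is at most a
constant multiple of `A ^ (1 - p)`. -/
lemma length_le_of_add_lintegral_rpow_le {p : ℝ} (hp : 1 < p) {w : ℝ → ℝ≥0∞} {M : ℝ≥0∞}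
    (hM : M ≠ ∞) {A : ℝ≥0∞} {B τ T : ℝ} (hB : 0 < B) (hBA : ENNReal.ofReal B ≤ A)
    (hwM : ∀ s, τ < s → s < T → w s ≤ M)
    (hw : ∀ s, τ < s → s < T → A + ∫⁻ r in Ioo τ s, w r ^ p ≤ w s) :
    T - τ ≤ (1 - 2 ^ (1 - p))⁻¹ * B ^ (1 - p) := by
  set ρ : ℝ := 2 ^ (1 - p) with hρ
  have hρ0 : 0 < ρ := by positivity
  have hρ1 : ρ < 1 := Real.rpow_lt_one_of_one_lt_of_neg one_lt_two (by linarith)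
  have h1ρ : 0 < 1 - ρ := sub_pos.2 hρ1
  by_contra! hlt
  set σ : ℕ → ℝ := fun n => τ + (1 - ρ)⁻¹ * B ^ (1 - p) * (1 - ρ ^ n) with hσ
  have hK : 0 < (1 - ρ)⁻¹ * B ^ (1 - p) := by positivity
  have hσ0 : σ 0 = τ := by simp [hσ]
  have hστ (n : ℕ) : τ ≤ σ n := by
    have : ρ ^ n ≤ 1 := pow_le_one₀ hρ0.le hρ1.le
    have := mul_nonneg hK.le (sub_nonneg.2 this)
    simp only [hσ]; linarith
  have hστ' (n : ℕ) : σ n < τ + (1 - ρ)⁻¹ * B ^ (1 - p) := by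
    have := mul_pos hK (pow_pos hρ0 n)
    simp only [hσ]; linarith
  have hstep (n : ℕ) : σ (n + 1) - σ n = B ^ (1 - p) * ρ ^ n := by
    simp only [hσ]; field_simp; ring
  have hgrow (n : ℕ) : ∀ s, σ n ≤ s → s < T →
      ENNReal.ofReal (2 ^ n * B) ≤ A + ∫⁻ r in Ioo τ s, w r ^ p := by
    induction n with
    | zero => intro s _ _; simpa using hBA.trans le_self_add
    | succ n ih =>
      intro s hs hsT
      have hlt' : σ n < σ (n + 1) := by
        have : 0 < B ^ (1 - p) * ρ ^ n := by positivity
        linarith [hstep n]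
      have hsub : Ioo τ (σ n) ∪ Ioo (σ n) (σ (n + 1)) ⊆ Ioo τ s :=
        union_subset (Ioo_subset_Ioo_right (hlt'.le.trans hs)) (Ioo_subset_Ioo (hστ n) hs)
      have hdisj : Disjoint (Ioo τ (σ n)) (Ioo (σ n) (σ (n + 1))) :=
        Set.disjoint_left.2 fun r h1 h2 => lt_asymm h1.2 h2.1
      have hpiece : ENNReal.ofReal (2 ^ n * B) ≤ ∫⁻ r in Ioo (σ n) (σ (n + 1)), w r ^ p := by
        have hge : ∀ r ∈ Ioo (σ n) (σ (n + 1)), ENNReal.ofReal (2 ^ n * B) ^ p ≤ w r ^ p := by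
          intro r hr
          have hrT : r < T := hr.2.trans_le (hs.trans hsT.le)
          exact ENNReal.rpow_le_rpow ((ih r hr.1.le hrT).trans
            (hw r ((hστ n).trans_lt hr.1) hrT)) (by linarith)
        refine le_trans (le_of_eq ?_) (setLIntegral_mono' measurableSet_Ioo hge)
        rw [setLIntegral_const, Real.volume_Ioo, hstep,
          ENNReal.ofReal_rpow_of_pos (by positivity), ← ENNReal.ofReal_mul (by positivity)]
        congr 1
        have e1 : ρ ^ n = (2 ^ n) ^ (1 - p) := by
          rw [hρ, ← Real.rpow_natCast, ← Real.rpow_natCast, ← Real.rpow_mul (by norm_num),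
            ← Real.rpow_mul (by norm_num), mul_comm]
        rw [e1, mul_comm (B ^ (1 - p)), ← Real.mul_rpow (by positivity) hB.le,
          ← Real.rpow_add (by positivity)]
        simp
      have hprev := ih (σ n) le_rfl (hlt'.trans_le (hs.trans hsT.le))
      calc ENNReal.ofReal (2 ^ (n + 1) * B)
          = ENNReal.ofReal (2 ^ n * B) + ENNReal.ofReal (2 ^ n * B) := by
            rw [← ENNReal.ofReal_add (by positivity) (by positivity)]; congr 1; ring
        _ ≤ (A + ∫⁻ r in Ioo τ (σ n), w r ^ p) +
              ∫⁻ r in Ioo (σ n) (σ (n + 1)), w r ^ p := add_le_add hprev hpiece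
        _ = A + ∫⁻ r in Ioo τ (σ n) ∪ Ioo (σ n) (σ (n + 1)), w r ^ p := by
            rw [lintegral_union measurableSet_Ioo hdisj, add_assoc]
        _ ≤ _ := by gcongr
  set s := τ + (1 - ρ)⁻¹ * B ^ (1 - p) with hs
  have hsT : s < T := by linarith
  have hbound (n : ℕ) : 2 ^ n * B ≤ M.toReal :=
    (ENNReal.ofReal_le_iff_le_toReal hM).1 <|
      ((hgrow n s (hστ' n).le hsT).trans (hw s (by linarith) hsT)).trans (hwM s (by linarith) hsT)
  obtain ⟨n, hn⟩ := pow_unbounded_of_one_lt (M.toReal / B) one_lt_two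
  rw [div_lt_iff₀ hB] at hn
  exact absurd (hbound n) (not_le.2 hn)

/-- Decay of the freely propagated solution. -/
lemma IsDuhamelSolution.exists_propagate_le {X : Type*} [MeasurableSpace X] {μ : Measure X}
    [SFinite μ] {k : X → X → ℝ → ℝ≥0∞} {p : ℝ} {f : X → ℝ≥0∞} {v : X → ℝ → ℝ≥0∞}
    (hk : IsTransitionDensity μ k) (hv : IsDuhamelSolution μ k p f v) (hp : 1 < p) :
    ∃ C : ℝ, 0 < C ∧ ∀ (x : X) (τ L : ℝ), 0 < τ → 0 < L →
      ∫⁻ y, k x y L * v y τ ∂μ ≤ ENNReal.ofReal (C * L ^ (-(1 / (p - 1)))) := by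
  have h1ρ : 0 < 1 - (2 : ℝ) ^ (1 - p) :=
    sub_pos.2 (Real.rpow_lt_one_of_one_lt_of_neg one_lt_two (by linarith))
  refine ⟨((1 - (2 : ℝ) ^ (1 - p))⁻¹) ^ (1 / (p - 1)), by positivity, fun x τ L hτ hL => ?_⟩
  obtain ⟨M, hM, hvM⟩ := hv.bounded
  have hle (s t : ℝ) (hs : 0 < s) (hst : s < t) : ∫⁻ y, k x y (t - s) * v y s ∂μ ≤ M := by
    calc ∫⁻ y, k x y (t - s) * v y s ∂μ ≤ ∫⁻ y, k x y (t - s) * M ∂μ := by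
          refine lintegral_mono_ae ?_
          filter_upwards [hvM s hs] with y hy
          gcongr
      _ = M := by
          have hm : Measurable fun y => k x y (t - s) :=
            hk.measurable.comp (f := fun y => (x, y, t - s)) (by fun_prop)
          rw [lintegral_mul_const _ hm, hk.lintegral_snd x _ (sub_pos.2 hst), one_mul]
  have hA := hle τ (τ + L) hτ (by linarith)
  rw [add_sub_cancel_left] at hA
  set A := ∫⁻ y, k x y L * v y τ ∂μ with hAdef
  have hAtop : A ≠ ∞ := ne_top_of_le_ne_top hM hA
  rcases eq_or_ne A 0 with h0 | h0
  · simp [h0]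
  have hB : 0 < A.toReal := ENNReal.toReal_pos h0 hAtop
  have hlen := length_le_of_add_lintegral_rpow_le (T := τ + L) (τ := τ) hp hM hB
    (ENNReal.ofReal_toReal hAtop).le
    (w := fun s => ∫⁻ y, k x y (τ + L - s) * v y s ∂μ)
    (fun s h1 h2 => hle s _ (hτ.trans h1) h2)
    (fun s h1 h2 => by
      have := hv.propagate_add_lintegral_rpow_le hk hp.le x hτ h1 h2
      rwa [add_sub_cancel_left] at this)
  rw [add_sub_cancel_left] at hlen
  rw [ENNReal.le_ofReal_iff_toReal_le hAtop (by positivity)]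
  have hp' : 0 < p - 1 := sub_pos.2 hp
  set B := A.toReal
  set K := (1 - (2 : ℝ) ^ (1 - p))⁻¹
  have hKp : 0 < K := inv_pos.2 h1ρ
  have hBp : B ^ (p - 1) ≤ K / L := by
    rw [le_div_iff₀ hL]
    calc B ^ (p - 1) * L ≤ B ^ (p - 1) * (K * B ^ (1 - p)) := by gcongr
      _ = K * (B ^ (p - 1) * B ^ (1 - p)) := by ring
      _ = K := by rw [← Real.rpow_add hB]; simp
  calc B = (B ^ (p - 1)) ^ (1 / (p - 1)) := by
        rw [← Real.rpow_mul hB.le, mul_one_div_cancel hp'.ne', Real.rpow_one]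
    _ ≤ (K / L) ^ (1 / (p - 1)) := by gcongr
    _ = K ^ (1 / (p - 1)) * L ^ (-(1 / (p - 1))) := by
        rw [Real.div_rpow hKp.le hL.le, Real.rpow_neg hL.le, div_eq_mul_inv]

lemma lintegral_Ioi_ofReal_inv {a : ℝ} (ha : 0 ≤ a) : ∫⁻ s in Ioi a, ENNReal.ofReal s⁻¹ = ∞ := by
  by_contra hfin
  refine not_integrableOn_Ioi_inv (a := a) ⟨measurable_inv.aestronglyMeasurable, ?_⟩
  rw [hasFiniteIntegral_iff_ofReal]
  · exact lt_top_iff_ne_top.2 hfin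
  · filter_upwards [ae_restrict_mem measurableSet_Ioi] with s hs
    exact inv_nonneg.2 (ha.trans (le_of_lt hs))

section Euclidean

variable {N : ℕ} {k : E N → E N → ℝ → ℝ≥0∞} {p α c : ℝ} {f : E N → ℝ≥0∞} {v : E N → ℝ → ℝ≥0∞}

lemma mul_setLIntegral_le_propagate
    (hlow : ∀ x y t, 0 < t → ‖x‖ ≤ t ^ α → ‖y‖ ≤ t ^ α →
      ENNReal.ofReal (c * t ^ (-(N * α))) ≤ k x y t)
    {g : E N → ℝ≥0∞} (hg : Measurable g) {L : ℝ} (hL : 0 < L) {x : E N} (hx : ‖x‖ ≤ L ^ α) :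
    ENNReal.ofReal (c * L ^ (-(N * α))) * ∫⁻ y in Metric.closedBall 0 (L ^ α), g y ≤
      ∫⁻ y, k x y L * g y := by
  rw [← lintegral_const_mul _ hg]
  refine le_trans (setLIntegral_mono' Metric.isClosed_closedBall.measurableSet fun y hy => ?_)
    (setLIntegral_le_lintegral _ _)
  gcongr
  exact hlow x y L hL hx (mem_closedBall_zero_iff.1 hy)

lemma lintegral_le_of_closedBall {g : E N → ℝ≥0∞} (hg : Measurable g) (hα : 0 < α) {C : ℝ≥0∞}
    (h : ∀ L : ℝ, 1 ≤ L → ∫⁻ y in Metric.closedBall 0 (L ^ α), g y ≤ C) : ∫⁻ y, g y ≤ C := by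
  have hr : Filter.Tendsto (fun n : ℕ => ((n : ℝ) + 1) ^ α) Filter.atTop Filter.atTop :=
    (tendsto_rpow_atTop hα).comp
      (Filter.tendsto_atTop_add_const_right _ _ tendsto_natCast_atTop_atTop)
  exact le_of_tendsto' ((aecover_closedBall (μ := volume) (x := (0 : E N)) hr).lintegral_tendsto_of_nat
    hg.aemeasurable) fun n => h _ (by linarith [n.cast_nonneg (α := ℝ)])

namespace IsDuhamelSolution

lemma exists_mass_le (hk : IsTransitionDensity volume k)
    (hv : IsDuhamelSolution volume k p f v) (hp : 1 < p) (hα : 0 < α) (hpα : (p - 1) * (N * α) ≤ 1)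
    (hc : 0 < c) (hlow : ∀ x y t, 0 < t → ‖x‖ ≤ t ^ α → ‖y‖ ≤ t ^ α →
      ENNReal.ofReal (c * t ^ (-(N * α))) ≤ k x y t) :
    ∃ C : ℝ≥0∞, C ≠ ∞ ∧ ∀ τ, 0 < τ → ∫⁻ y, v y τ ≤ C := by
  obtain ⟨C, hC, hdecay⟩ := hv.exists_propagate_le hk hp
  refine ⟨ENNReal.ofReal (C / c), ENNReal.ofReal_ne_top, fun τ hτ =>
    lintegral_le_of_closedBall (hv.measurable_slice τ) hα fun L hL => ?_⟩
  have hL0 : 0 < L := one_pos.trans_le hL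
  have hpos : 0 < c * L ^ (-(N * α)) := by positivity
  have hexp : L ^ (-(1 / (p - 1))) ≤ L ^ (-(N * α)) := by
    refine Real.rpow_le_rpow_of_exponent_le hL (neg_le_neg ?_)
    rwa [le_div_iff₀ (sub_pos.2 hp), mul_comm]
  have h := calc
    ENNReal.ofReal (c * L ^ (-(N * α))) * ∫⁻ y in Metric.closedBall 0 (L ^ α), v y τ
      ≤ ∫⁻ y, k 0 y L * v y τ :=
        mul_setLIntegral_le_propagate hlow (hv.measurable_slice τ) hL0 (by simp; positivity)
    _ ≤ ENNReal.ofReal (C * L ^ (-(1 / (p - 1)))) := hdecay 0 τ L hτ hL0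
    _ ≤ ENNReal.ofReal (C * L ^ (-(N * α))) := by gcongr
    _ = ENNReal.ofReal (c * L ^ (-(N * α))) * ENNReal.ofReal (C / c) := by
        rw [← ENNReal.ofReal_mul hpos.le]; congr 1; field_simp
  exact (ENNReal.mul_le_mul_iff_right (by simpa using hpos) ENNReal.ofReal_ne_top).1 h

/-- A critical or subcritical global solution has no mass at any positive time. -/
lemma lintegral_eq_zero (hk : IsTransitionDensity volume k)
    (hv : IsDuhamelSolution volume k p f v) (hp : 1 < p) (hα : 0 < α) (hpα : (p - 1) * (N * α) ≤ 1)
    (hc : 0 < c) (hlow : ∀ x y t, 0 < t → ‖x‖ ≤ t ^ α → ‖y‖ ≤ t ^ α →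
      ENNReal.ofReal (c * t ^ (-(N * α))) ≤ k x y t) {τ : ℝ} (hτ : 0 < τ) :
    ∫⁻ y, v y τ = 0 := by
  obtain ⟨C, hC, hmass⟩ := hv.exists_mass_le hk hp hα hpα hc hlow
  have hp0 : 0 < p := one_pos.trans hp
  by_contra hne
  obtain ⟨L₀, hL₀, hm0⟩ : ∃ L : ℝ, 1 ≤ L ∧ ∫⁻ y in Metric.closedBall 0 (L ^ α), v y τ ≠ 0 := by
    by_contra! hcon
    exact hne (le_zero_iff.1 (lintegral_le_of_closedBall (hv.measurable_slice τ) hα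
      fun L hL => (hcon L hL).le))
  set m := ∫⁻ y in Metric.closedBall 0 (L₀ ^ α), v y τ with hm
  have hmtop : m ≠ ∞ :=
    ne_top_of_le_ne_top hC ((setLIntegral_le_lintegral _ _).trans (hmass τ hτ))
  have hmpos : 0 < m.toReal := ENNReal.toReal_pos hm0 hmtop
  set V := volume (Metric.ball (0 : E N) 1)
  have hV : V ≠ 0 := (Metric.measure_ball_pos volume 0 one_pos).ne'
  set K := (c * m.toReal) ^ p with hK
  have hKpos : 0 < K := by positivity
  have hlower (r : ℝ) (hr : L₀ < r) :
      ENNReal.ofReal K * V * ENNReal.ofReal r⁻¹ ≤ ∫⁻ x, v x (τ + r) ^ p := by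
    have hr1 : 1 < r := hL₀.trans_lt hr
    have hr0 : 0 < r := one_pos.trans hr1
    have hpt : ∀ᵐ x, x ∈ Metric.closedBall (0 : E N) (r ^ α) →
        ENNReal.ofReal (c * r ^ (-(N * α)) * m.toReal) ^ p ≤ v x (τ + r) ^ p := by
      filter_upwards [hv.lintegral_propagate_le hk hτ (lt_add_of_pos_right τ hr0)] with x hx hxr
      rw [add_sub_cancel_left] at hx
      refine ENNReal.rpow_le_rpow ?_ hp0.le
      refine le_trans ?_ ((mul_setLIntegral_le_propagate hlow (hv.measurable_slice τ) hr0
        (mem_closedBall_zero_iff.1 hxr)).trans hx)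
      rw [ENNReal.ofReal_mul (by positivity), ENNReal.ofReal_toReal hmtop]
      gcongr
      exact lintegral_mono_set (Metric.closedBall_subset_closedBall
        (Real.rpow_le_rpow (by linarith) hr.le hα.le))
    have hscal : K * r⁻¹ ≤ (c * r ^ (-(N * α)) * m.toReal) ^ p * (r ^ α) ^ N := by
      have e : (c * r ^ (-(N * α)) * m.toReal) ^ p * (r ^ α) ^ N =
          K * r ^ (-((p - 1) * (N * α))) := by
        rw [mul_right_comm, Real.mul_rpow (by positivity) (by positivity), ← hK, mul_assoc,
          ← Real.rpow_mul hr0.le, ← Real.rpow_natCast, ← Real.rpow_mul hr0.le,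
          ← Real.rpow_add hr0]
        congr 2; ring
      rw [e, ← Real.rpow_neg_one]
      gcongr
      exact hr1.le
    calc ENNReal.ofReal K * V * ENNReal.ofReal r⁻¹ = ENNReal.ofReal (K * r⁻¹) * V := by
          rw [ENNReal.ofReal_mul hKpos.le]; ring
      _ ≤ ENNReal.ofReal ((c * r ^ (-(N * α)) * m.toReal) ^ p * (r ^ α) ^ N) * V := by gcongr
      _ = ∫⁻ _ in Metric.closedBall (0 : E N) (r ^ α),
            ENNReal.ofReal (c * r ^ (-(N * α)) * m.toReal) ^ p := by
          rw [setLIntegral_const, Measure.addHaar_closedBall _ _ (by positivity),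
            finrank_euclideanSpace_fin, ENNReal.ofReal_mul (by positivity),
            ENNReal.ofReal_rpow_of_nonneg (by positivity) hp0.le, mul_assoc]
      _ ≤ ∫⁻ x in Metric.closedBall (0 : E N) (r ^ α), v x (τ + r) ^ p :=
          setLIntegral_mono_ae' Metric.isClosed_closedBall.measurableSet hpt
      _ ≤ _ := setLIntegral_le_lintegral _ _
  have htotal : ∫⁻ s in Ioi 0, ∫⁻ x, v x s ^ p ≤ C := by
    have hmeas : Measurable fun s => ∫⁻ x, v x s ^ p :=
      (hv.measurable.pow_const p).lintegral_prod_left'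
    have hcov := aecover_Iio (μ := (volume : Measure ℝ).restrict (Ioi 0))
      (tendsto_natCast_atTop_atTop (R := ℝ))
    refine le_of_tendsto (hcov.lintegral_tendsto_of_nat hmeas.aemeasurable) ?_
    filter_upwards [Filter.eventually_gt_atTop 0] with n hn
    have hn' : (0 : ℝ) < n := Nat.cast_pos.2 hn
    rw [Measure.restrict_restrict measurableSet_Iio, inter_comm, Ioi_inter_Iio]
    exact (hv.lintegral_rpow_le hk hn').trans (hmass n hn')
  refine hC (top_le_iff.1 (le_trans ?_ htotal))
  have hsub : Ioi (τ + L₀) ⊆ Ioi 0 := Ioi_subset_Ioi (by linarith)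
  calc ∞ = ENNReal.ofReal K * V * ∫⁻ s in Ioi (τ + L₀), ENNReal.ofReal s⁻¹ := by
        rw [lintegral_Ioi_ofReal_inv (by linarith), ENNReal.mul_top]
        exact mul_ne_zero (by simpa using hKpos) hV
    _ = ∫⁻ s in Ioi (τ + L₀), ENNReal.ofReal K * V * ENNReal.ofReal s⁻¹ :=
        (lintegral_const_mul _ measurable_inv.ennreal_ofReal).symm
    _ ≤ ∫⁻ s in Ioi (τ + L₀), ∫⁻ x, v x s ^ p := by
        refine setLIntegral_mono' measurableSet_Ioi fun s hs => ?_
        have hs' : L₀ < s - τ := lt_sub_iff_add_lt'.2 hs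
        have h := hlower (s - τ) hs'
        rw [add_sub_cancel] at h
        refine le_trans ?_ h
        gcongr
        · linarith
        · linarith
    _ ≤ _ := lintegral_mono_set hsub

end IsDuhamelSolution

end Euclidean

lemma isTransitionDensity_ofReal {X : Type*} [MeasurableSpace X] {μ : Measure X}
    {Γ : X → X → ℝ → ℝ} (hmeas : Measurable fun q : X × X × ℝ => Γ q.1 q.2.1 q.2.2)
    (hpos : ∀ x y t, 0 < t → 0 < Γ x y t)
    (hfst : ∀ y t, 0 < t → ∫ x, Γ x y t ∂μ = 1) (hsnd : ∀ x t, 0 < t → ∫ y, Γ x y t ∂μ = 1)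
    (hcomp : ∀ x y s t, 0 < s → s < t → Γ x y t = ∫ ξ, Γ x ξ (t - s) * Γ ξ y s ∂μ) :
    IsTransitionDensity μ fun x y t => ENNReal.ofReal (Γ x y t) := by
  have key {g : X → ℝ} (hg : ∀ x, 0 ≤ g x) (h : ∫ x, g x ∂μ ≠ 0) :
      ∫⁻ x, ENNReal.ofReal (g x) ∂μ = ENNReal.ofReal (∫ x, g x ∂μ) :=
    (ofReal_integral_eq_lintegral_ofReal (Integrable.of_integral_ne_zero h)
      (Filter.Eventually.of_forall hg)).symm
  refine ⟨hmeas.ennreal_ofReal, fun y t ht => ?_, fun x t ht => ?_, fun x y s t hs hst => ?_⟩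
  · rw [key (fun x => (hpos x y t ht).le) (by simp [hfst y t ht]), hfst y t ht, ENNReal.ofReal_one]
  · rw [key (fun y => (hpos x y t ht).le) (by simp [hsnd x t ht]), hsnd x t ht, ENNReal.ofReal_one]
  · have hts : 0 < t - s := sub_pos.2 hst
    have hint := hcomp x y s t hs hst
    simp_rw [← ENNReal.ofReal_mul (hpos _ _ _ hts).le]
    rw [key (fun ξ => (mul_pos (hpos x ξ _ hts) (hpos ξ y s hs)).le)
      (hint ▸ (hpos x y t (hs.trans hst)).ne'), ← hint]

lemma IsMildSolution.isDuhamelSolution {N : ℕ} {p : ℝ} (hp : 0 ≤ p) {Γ : E N → E N → ℝ → ℝ}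
    (hpos : ∀ x y t, 0 < t → 0 < Γ x y t) {φ : E N → ℝ} (hφm : Measurable φ) (hφ : ∀ x, 0 ≤ φ x)
    {u : E N → ℝ → ℝ} (hu : IsMildSolution N p Γ φ ⊤ u) :
    IsDuhamelSolution volume (fun x y t => ENNReal.ofReal (Γ x y t)) p
      (fun y => ENNReal.ofReal (φ y)) fun x t => ENNReal.ofReal (u x t) := by
  obtain ⟨hum, hu0, ⟨M, hM⟩, hduh⟩ := hu
  refine ⟨hum.ennreal_ofReal, hφm.ennreal_ofReal,
    ⟨ENNReal.ofReal M, ENNReal.ofReal_ne_top, fun t ht => ?_⟩, fun t ht => ?_⟩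
  · filter_upwards [hM t ht ENNReal.ofReal_lt_top] with x hx
    exact ENNReal.ofReal_le_ofReal hx
  · filter_upwards [hduh t ht ENNReal.ofReal_lt_top] with x ⟨hi1, hi2, hx⟩
    have hlin : ∫⁻ y, ENNReal.ofReal (Γ x y t) * ENNReal.ofReal (φ y) =
        ENNReal.ofReal (∫ y, Γ x y t * φ y) := by
      rw [ofReal_integral_eq_lintegral_ofReal hi1
        (Filter.Eventually.of_forall fun y => mul_nonneg (hpos x y t ht).le (hφ y))]
      simp_rw [ENNReal.ofReal_mul (hpos x _ t ht).le]
    have hnn : 0 ≤ᵐ[volume.prod (volume.restrict (Ioo (0 : ℝ) t))]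
        fun q : E N × ℝ => Γ x q.1 (t - q.2) * u q.1 q.2 ^ p := by
      have hsnd := Measure.quasiMeasurePreserving_snd (μ := (volume : Measure (E N)))
        (ν := (volume : Measure ℝ).restrict (Ioo 0 t))
      filter_upwards [hsnd.ae (ae_restrict_mem measurableSet_Ioo)] with q hq
      exact mul_nonneg (hpos x q.1 _ (sub_pos.2 hq.2)).le (Real.rpow_nonneg (hu0 _ _) _)
    have hnonlin : ∫⁻ s in Ioo 0 t, ∫⁻ y, ENNReal.ofReal (Γ x y (t - s)) *
          ENNReal.ofReal (u y s) ^ p =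
        ENNReal.ofReal (∫ s in Ioo 0 t, ∫ y, Γ x y (t - s) * u y s ^ p) := by
      rw [← integral_prod_symm _ hi2, ofReal_integral_eq_lintegral_ofReal hi2 hnn,
        lintegral_prod_symm _ hi2.aestronglyMeasurable.aemeasurable.ennreal_ofReal]
      refine setLIntegral_congr_fun measurableSet_Ioo fun s hs => lintegral_congr fun y => ?_
      rw [ENNReal.ofReal_mul (hpos x y _ (sub_pos.2 hs.2)).le,
        ENNReal.ofReal_rpow_of_nonneg (hu0 y s) hp]
    rw [hlin, hnonlin, hx, ENNReal.ofReal_add]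
    · exact integral_nonneg fun y => mul_nonneg (hpos x y t ht).le (hφ y)
    · exact setIntegral_nonneg measurableSet_Ioo fun s hs => integral_nonneg fun y =>
        mul_nonneg (hpos x y _ (sub_pos.2 hs.2)).le (Real.rpow_nonneg (hu0 _ _) _)

/-- Theorem 1.1: nonexistence of nontrivial global-in-time solutions for
`1 < p ≤ 1 + (2-a)/N`, for any positive kernel satisfying (K1), (K2) and the
lower Gaussian-type bound. -/
theorem no_global_solution_line_weight
    (N : ℕ) (hN : 1 ≤ N) (a : ℝ) (ha1 : -1 < a) (ha2 : a < 1) (haN : a * N < 2)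
    (p : ℝ) (hp1 : 1 < p) (hp2 : p ≤ 1 + (2 - a) / N)
    (Γ : E N → E N → ℝ → ℝ)
    (hΓmeas : Measurable (fun q : E N × E N × ℝ => Γ q.1 q.2.1 q.2.2))
    (hΓpos : ∀ x y : E N, ∀ t : ℝ, 0 < t → 0 < Γ x y t)
    (hK1x : ∀ y : E N, ∀ t : ℝ, 0 < t → ∫ x : E N, Γ x y t = 1)
    (hK1y : ∀ x : E N, ∀ t : ℝ, 0 < t → ∫ y : E N, Γ x y t = 1)
    (hK2 : ∀ x y : E N, ∀ s t : ℝ, 0 < s → s < t →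
      Γ x y t = ∫ ξ : E N, Γ x ξ (t - s) * Γ ξ y s)
    (hlow : ∃ c₁ c₂ : ℝ, 0 < c₁ ∧ 0 < c₂ ∧ ∀ x y : E N, ∀ t : ℝ, 0 < t →
      |y ⟨0, hN⟩| ≤ t ^ (1 / (2 - a)) →
      c₁ * t ^ (-(N : ℝ) / (2 - a)) *
        Real.exp (-c₂ * (‖x - y‖ ^ (2 - a) / t) ^ (1 / (1 - a))) ≤ Γ x y t)
    (φ : E N → ℝ) (hφmeas : Measurable φ) (hφ : ∀ x, 0 ≤ φ x)
    (u : E N → ℝ → ℝ) (hu : IsMildSolution N p Γ φ ⊤ u) :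
    ∀ᵐ q ∂((volume : Measure (E N)).prod (volume.restrict (Ioi (0:ℝ)))),
      u q.1 q.2 = 0 := by
  obtain ⟨c₁, c₂, hc₁, hc₂, hΓlow⟩ := hlow
  have h2a : 0 < 2 - a := by linarith
  have h1a : 0 < 1 - a := by linarith
  have hN0 : (0 : ℝ) < N := Nat.cast_pos.2 hN
  have hk := isTransitionDensity_ofReal hΓmeas hΓpos hK1x hK1y hK2
  have hv := hu.isDuhamelSolution (by linarith) hΓpos hφmeas hφ
  set α := 1 / (2 - a) with hα
  have hα0 : 0 < α := by positivity
  have hpα : (p - 1) * (N * α) ≤ 1 := by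
    calc (p - 1) * (N * α) ≤ (2 - a) / N * (N * α) := by gcongr; linarith
      _ = 1 := by rw [hα]; field_simp
  set c := c₁ * Real.exp (-c₂ * (2 ^ (2 - a)) ^ (1 / (1 - a))) with hc
  have hlow : ∀ (x y : E N) (t : ℝ), 0 < t → ‖x‖ ≤ t ^ α → ‖y‖ ≤ t ^ α →
      ENNReal.ofReal (c * t ^ (-(N * α))) ≤ ENNReal.ofReal (Γ x y t) := by
    intro x y t ht hx hy
    refine ENNReal.ofReal_le_ofReal (le_trans ?_
      (hΓlow x y t ht ((PiLp.norm_apply_le y ⟨0, hN⟩).trans hy)))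
    have hdist : ‖x - y‖ ^ (2 - a) / t ≤ 2 ^ (2 - a) := by
      rw [div_le_iff₀ ht]
      calc ‖x - y‖ ^ (2 - a) ≤ (2 * t ^ α) ^ (2 - a) := by
            gcongr
            linarith [norm_sub_le x y]
        _ = 2 ^ (2 - a) * t := by
            rw [Real.mul_rpow (by norm_num) (by positivity), ← Real.rpow_mul ht.le, hα,
              one_div_mul_cancel h2a.ne', Real.rpow_one]
    have hexp : -(N : ℝ) / (2 - a) = -(N * α) := by rw [hα]; ring
    rw [hexp, hc, mul_right_comm]
    gcongr c₁ * t ^ (-(N * α)) * Real.exp ?_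
    rw [neg_mul, neg_mul, neg_le_neg_iff]
    gcongr
  have hslice : ∀ t : ℝ, 0 < t → ∀ᵐ x : E N, u x t = 0 := by
    intro t ht
    have h := hv.lintegral_eq_zero hk hp1 hα0 hpα (by positivity : 0 < c) hlow ht
    rw [lintegral_eq_zero_iff (hv.measurable_slice t)] at h
    filter_upwards [h] with x hx
    exact le_antisymm (ENNReal.ofReal_eq_zero.1 hx) (hu.2.1 x t)
  have hset : MeasurableSet {q : E N × ℝ | u q.1 q.2 = 0} := hu.1 (measurableSet_singleton 0)
  rw [Measure.ae_prod_iff_ae_ae hset, Measure.ae_ae_comm hset]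
  filter_upwards [ae_restrict_mem measurableSet_Ioi] with t ht
  exact hslice t ht
end
end

section
/- Let N ≥ 1 and let b be a real number with −N < b < 1. Let p satisfy 1 < p ≤ 1 + (2−b)/N. Let Γ : ℝ^N × ℝ^N × (0,∞) → ℝ be a measurable kernel which is positive, satisfies (K1) and (K2), and satisfies the lower Gaussian-type bound: there exist c₁, c₂ > 0 such that Γ(x,y,t) ≥ c₁ t^{−N/(2−b)} exp(−c₂ (|x−y|^{(2−b)}/t)^{1/(1−b)}) for all x, y ∈ ℝ^N and t > 0 with |y| ≤ t^{1/(2−b)}. Then there is no nontrivial global-in-time mild solution: if φ is a nonnegative measurable function on ℝ^N and u is a mild solution of u_t = div(w∇u) + u^p with kernel Γ and initial data φ on ℝ^N × (0,∞), then u = 0 almost everywhere on ℝ^N × (0,∞). -/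
open MeasureTheory Real Set
open scoped ENNReal

noncomputable section

section ExtendedKernel

variable {X : Type*} [MeasurableSpace X] {μ : Measure X}

/-- A jointly measurable `ℝ≥0∞`-valued kernel on `X × X × (0,∞)` with unit mass in each space
variable and the semigroup property. -/
structure BistochasticSemigroup (μ : Measure X) (G : X → X → ℝ → ℝ≥0∞) : Prop where
  measurable : Measurable fun q : X × X × ℝ => G q.1 q.2.1 q.2.2
  lintegral_fst : ∀ y t, 0 < t → ∫⁻ x, G x y t ∂μ = 1
  lintegral_snd : ∀ x t, 0 < t → ∫⁻ y, G x y t ∂μ = 1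
  comp : ∀ x y s t, 0 < s → s < t → G x y t = ∫⁻ ξ, G x ξ (t - s) * G ξ y s ∂μ

/-- The `ℝ≥0∞`-valued Duhamel identity for `u_t = L u + u ^ p` on `(0,∞)`. -/
structure DuhamelSolution (μ : Measure X) (p : ℝ) (G : X → X → ℝ → ℝ≥0∞) (Φ : X → ℝ≥0∞)
    (U : X → ℝ → ℝ≥0∞) : Prop where
  measurable_data : Measurable Φ
  measurable : Measurable fun q : X × ℝ => U q.1 q.2
  eq : ∀ t, 0 < t → ∀ᵐ x ∂μ, U x t = (∫⁻ y, G x y t * Φ y ∂μ) +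
    ∫⁻ r in Ioo 0 t, ∫⁻ y, G x y (t - r) * U y r ^ p ∂μ

theorem lintegral_mul_lintegral_mul [SFinite μ] {k₁ k f : X → ℝ≥0∞} {k₂ : X → X → ℝ≥0∞}
    (hk₁ : Measurable k₁) (hk₂ : Measurable (Function.uncurry k₂)) (hf : Measurable f)
    (h : ∀ y, k y = ∫⁻ ξ, k₁ ξ * k₂ ξ y ∂μ) :
    ∫⁻ ξ, k₁ ξ * ∫⁻ y, k₂ ξ y * f y ∂μ ∂μ = ∫⁻ y, k y * f y ∂μ := by
  have hk₂' : ∀ ξ, Measurable (k₂ ξ) := fun ξ => hk₂.comp measurable_prodMk_left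
  have hk₂'' : ∀ y, Measurable (fun ξ => k₂ ξ y) := fun y => hk₂.comp measurable_prodMk_right
  calc ∫⁻ ξ, k₁ ξ * ∫⁻ y, k₂ ξ y * f y ∂μ ∂μ
      = ∫⁻ ξ, ∫⁻ y, k₁ ξ * (k₂ ξ y * f y) ∂μ ∂μ := by
        refine lintegral_congr fun ξ => ?_
        rw [lintegral_const_mul]
        exact (hk₂' ξ).mul hf
    _ = ∫⁻ y, ∫⁻ ξ, k₁ ξ * (k₂ ξ y * f y) ∂μ ∂μ := by
        refine lintegral_lintegral_swap (Measurable.aemeasurable ?_)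
        exact (hk₁.comp measurable_fst).mul (hk₂.mul (hf.comp measurable_snd))
    _ = ∫⁻ y, k y * f y ∂μ := by
        refine lintegral_congr fun y => ?_
        rw [h y, ← lintegral_mul_const _ (f := fun ξ => k₁ ξ * k₂ ξ y) (hk₁.mul (hk₂'' y))]
        exact lintegral_congr fun ξ => (mul_assoc _ _ _).symm

/-- Jensen's inequality for `z ↦ z ^ p` and a probability density `k`. -/
theorem rpow_lintegral_mul_le_of_lintegral_eq_one {p : ℝ} (hp : 1 < p) {k f : X → ℝ≥0∞}
    (hk : Measurable k) (hf : Measurable f) (h : ∫⁻ x, k x ∂μ = 1) :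
    (∫⁻ x, k x * f x ∂μ) ^ p ≤ ∫⁻ x, k x * f x ^ p ∂μ := by
  have hp0 : 0 < p := by linarith
  have hp' : 0 ≤ 1 - 1 / p := by
    rw [sub_nonneg, div_le_one hp0]; exact hp.le
  have key := ENNReal.lintegral_mul_norm_pow_le (μ := μ) (f := fun x => k x * f x ^ p) (g := k)
    (hk.mul (hf.pow_const p)).aemeasurable hk.aemeasurable (p := 1 / p) (q := 1 - 1 / p)
    (by positivity) hp' (by ring)
  have e : ∀ x, (k x * f x ^ p) ^ (1 / p) * k x ^ (1 - 1 / p) = k x * f x := by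
    intro x
    rw [ENNReal.mul_rpow_of_nonneg _ _ (by positivity : 0 ≤ 1 / p), ← ENNReal.rpow_mul,
      mul_one_div_cancel hp0.ne', ENNReal.rpow_one, mul_right_comm,
      ← ENNReal.rpow_add_of_nonneg _ _ (by positivity) hp', add_sub_cancel, ENNReal.rpow_one]
  simp only [e, h, ENNReal.one_rpow, mul_one] at key
  calc (∫⁻ x, k x * f x ∂μ) ^ p ≤ ((∫⁻ x, k x * f x ^ p ∂μ) ^ (1 / p)) ^ p :=
        ENNReal.rpow_le_rpow key hp0.le
    _ = ∫⁻ x, k x * f x ^ p ∂μ := by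
        rw [← ENNReal.rpow_mul, one_div_mul_cancel hp0.ne', ENNReal.rpow_one]

namespace BistochasticSemigroup

variable {G : X → X → ℝ → ℝ≥0∞}

theorem measurable_snd (hG : BistochasticSemigroup μ G) (x : X) (t : ℝ) :
    Measurable fun y => G x y t :=
  hG.measurable.comp (by fun_prop : Measurable fun y : X => (x, y, t))

theorem measurable_space (hG : BistochasticSemigroup μ G) (t : ℝ) :
    Measurable (Function.uncurry fun x y => G x y t) :=
  hG.measurable.comp (by fun_prop : Measurable fun q : X × X => (q.1, q.2, t))

end BistochasticSemigroup

namespace DuhamelSolution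

variable {G : X → X → ℝ → ℝ≥0∞} {p : ℝ} {Φ : X → ℝ≥0∞} {U : X → ℝ → ℝ≥0∞}

theorem measurable_space (hU : DuhamelSolution μ p G Φ U) (t : ℝ) : Measurable fun x => U x t :=
  hU.measurable.comp (by fun_prop : Measurable fun x : X => (x, t))

/-- Applying the semigroup to a solution reproduces the Duhamel formula, at every point. -/
theorem lintegral_mul_eq [SFinite μ] (hG : BistochasticSemigroup μ G)
    (hU : DuhamelSolution μ p G Φ U) (x : X) {s t : ℝ} (hs : 0 < s) (hst : s < t) :
    ∫⁻ y, G x y (t - s) * U y s ∂μ = (∫⁻ y, G x y t * Φ y ∂μ) +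
      ∫⁻ r in Ioo 0 s, ∫⁻ y, G x y (t - r) * U y r ^ p ∂μ := by
  have hm : Measurable fun q : (X × ℝ) × X => G q.1.1 q.2 (s - q.1.2) * U q.2 q.1.2 ^ p :=
    (hG.measurable.comp (by fun_prop :
      Measurable fun q : (X × ℝ) × X => (q.1.1, q.2, s - q.1.2))).mul
      ((hU.measurable.comp (by fun_prop :
        Measurable fun q : (X × ℝ) × X => (q.2, q.1.2))).pow_const p)
  have hm' : Measurable fun q : X × ℝ => ∫⁻ y, G q.1 y (s - q.2) * U y q.2 ^ p ∂μ :=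
    hm.lintegral_prod_right'
  have hk := hG.measurable_snd x (t - s)
  calc ∫⁻ y, G x y (t - s) * U y s ∂μ
      = ∫⁻ ξ, (G x ξ (t - s) * (∫⁻ y, G ξ y s * Φ y ∂μ) + G x ξ (t - s) *
          ∫⁻ r in Ioo 0 s, ∫⁻ y, G ξ y (s - r) * U y r ^ p ∂μ) ∂μ := by
        refine lintegral_congr_ae ?_
        filter_upwards [hU.eq s hs] with ξ hξ
        rw [hξ, mul_add]
    _ = (∫⁻ ξ, G x ξ (t - s) * (∫⁻ y, G ξ y s * Φ y ∂μ) ∂μ) + ∫⁻ ξ, G x ξ (t - s) *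
          (∫⁻ r in Ioo 0 s, ∫⁻ y, G ξ y (s - r) * U y r ^ p ∂μ) ∂μ := by
        refine lintegral_add_right _ (hk.mul ?_)
        exact Measurable.lintegral_prod_right' (ν := volume.restrict (Ioo 0 s)) hm'
    _ = _ := by
        congr 1
        · exact lintegral_mul_lintegral_mul hk (hG.measurable_space s) hU.measurable_data
            fun y => hG.comp x y s t hs hst
        · calc ∫⁻ ξ, G x ξ (t - s) *
                (∫⁻ r in Ioo 0 s, ∫⁻ y, G ξ y (s - r) * U y r ^ p ∂μ) ∂μ
              = ∫⁻ ξ, (∫⁻ r in Ioo 0 s, G x ξ (t - s) *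
                  ∫⁻ y, G ξ y (s - r) * U y r ^ p ∂μ) ∂μ := by
                refine lintegral_congr fun ξ => ?_
                rw [lintegral_const_mul]
                exact hm'.comp measurable_prodMk_left
            _ = ∫⁻ r in Ioo 0 s, ∫⁻ ξ, G x ξ (t - s) *
                  ∫⁻ y, G ξ y (s - r) * U y r ^ p ∂μ ∂μ := by
                refine lintegral_lintegral_swap (Measurable.aemeasurable ?_)
                exact (hk.comp measurable_fst).mul hm'
            _ = _ := by
                refine setLIntegral_congr_fun measurableSet_Ioo fun r hr => ?_
                refine lintegral_mul_lintegral_mul hk (hG.measurable_space (s - r))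
                  ((hU.measurable_space r).pow_const p) fun y => ?_
                have := hG.comp x y (s - r) (t - r) (by linarith [hr.2]) (by linarith)
                rwa [sub_sub_sub_cancel_right] at this

theorem lintegral_mul_le [SFinite μ] (hG : BistochasticSemigroup μ G)
    (hU : DuhamelSolution μ p G Φ U) {τ t : ℝ} (hτ : 0 < τ) (hτt : τ < t) :
    ∀ᵐ x ∂μ, ∫⁻ y, G x y (t - τ) * U y τ ∂μ ≤ U x t := by
  filter_upwards [hU.eq t (hτ.trans hτt)] with x hx
  rw [hx, hU.lintegral_mul_eq hG x hτ hτt]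
  gcongr

theorem lintegral_mul_add_le [SFinite μ] (hp : 1 < p) (hG : BistochasticSemigroup μ G)
    (hU : DuhamelSolution μ p G Φ U) (x : X) {τ s t : ℝ} (hτ : 0 < τ) (hτs : τ < s)
    (hst : s < t) :
    (∫⁻ y, G x y (t - τ) * U y τ ∂μ) +
      ∫⁻ r in Ioo τ s, (∫⁻ y, G x y (t - r) * U y r ∂μ) ^ p ≤
      ∫⁻ y, G x y (t - s) * U y s ∂μ := by
  rw [hU.lintegral_mul_eq hG x hτ (hτs.trans hst), hU.lintegral_mul_eq hG x (hτ.trans hτs) hst,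
    add_assoc]
  gcongr
  calc (∫⁻ r in Ioo 0 τ, ∫⁻ y, G x y (t - r) * U y r ^ p ∂μ) +
        ∫⁻ r in Ioo τ s, (∫⁻ y, G x y (t - r) * U y r ∂μ) ^ p
      ≤ (∫⁻ r in Ioo 0 τ, ∫⁻ y, G x y (t - r) * U y r ^ p ∂μ) +
        ∫⁻ r in Ioo τ s, ∫⁻ y, G x y (t - r) * U y r ^ p ∂μ := by
        refine add_le_add le_rfl ?_
        refine setLIntegral_mono' measurableSet_Ioo fun r hr => ?_
        exact rpow_lintegral_mul_le_of_lintegral_eq_one hp (hG.measurable_snd x (t - r))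
          (hU.measurable_space r) (hG.lintegral_snd x (t - r) (by linarith [hr.2]))
    _ = ∫⁻ r in Ioo 0 τ ∪ Ioo τ s, ∫⁻ y, G x y (t - r) * U y r ^ p ∂μ := by
        rw [lintegral_union measurableSet_Ioo]
        exact Set.disjoint_left.2 fun r h₁ h₂ => lt_asymm h₁.2 h₂.1
    _ ≤ _ := by
        refine lintegral_mono_set (union_subset ?_ ?_)
        · exact Ioo_subset_Ioo le_rfl hτs.le
        · exact Ioo_subset_Ioo hτ.le le_rfl

/-- The source term feeds the total mass. -/
theorem lintegral_source_le_mass [SFinite μ] (hG : BistochasticSemigroup μ G)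
    (hU : DuhamelSolution μ p G Φ U) {t : ℝ} (ht : 0 < t) :
    ∫⁻ r in Ioo 0 t, ∫⁻ y, U y r ^ p ∂μ ≤ ∫⁻ x, U x t ∂μ := by
  have hm : Measurable fun q : (X × ℝ) × X => G q.1.1 q.2 (t - q.1.2) * U q.2 q.1.2 ^ p :=
    (hG.measurable.comp (by fun_prop :
      Measurable fun q : (X × ℝ) × X => (q.1.1, q.2, t - q.1.2))).mul
      ((hU.measurable.comp (by fun_prop :
        Measurable fun q : (X × ℝ) × X => (q.2, q.1.2))).pow_const p)
  calc ∫⁻ r in Ioo 0 t, ∫⁻ y, U y r ^ p ∂μ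
      = ∫⁻ r in Ioo 0 t, ∫⁻ x, ∫⁻ y, G x y (t - r) * U y r ^ p ∂μ ∂μ := by
        refine setLIntegral_congr_fun measurableSet_Ioo fun r hr => ?_
        rw [lintegral_lintegral_swap]
        · refine lintegral_congr fun y => ?_
          rw [lintegral_mul_const, hG.lintegral_fst y _ (by linarith [hr.2]), one_mul]
          exact (hG.measurable_space (t - r)).comp measurable_prodMk_right
        · exact (hm.comp (by fun_prop : Measurable fun q : X × X => ((q.1, r), q.2))).aemeasurable
    _ = ∫⁻ x, (∫⁻ r in Ioo 0 t, ∫⁻ y, G x y (t - r) * U y r ^ p ∂μ) ∂μ := by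
        rw [lintegral_lintegral_swap]
        exact (hm.lintegral_prod_right'.comp measurable_swap).aemeasurable
    _ ≤ ∫⁻ x, U x t ∂μ := by
        refine lintegral_mono_ae ?_
        filter_upwards [hU.eq t ht] with x hx
        rw [hx]
        exact le_add_self

end DuhamelSolution

end ExtendedKernel

/-- Blow-up for the integral inequality `A + ∫ f ^ p ≤ f`: a bounded solution has a lifespan
controlled by `A ^ (1 - p)`. -/
theorem lifespan_mul_rpow_le {p : ℝ} (hp : 1 < p) {τ t A M : ℝ} (hA : 0 < A) {f : ℝ → ℝ≥0∞}
    (hf : ∀ s, τ < s → s < t → ENNReal.ofReal A + ∫⁻ r in Ioo τ s, f r ^ p ≤ f s)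
    (hM : ∀ s, τ < s → s < t → f s ≤ ENNReal.ofReal M) :
    (t - τ) * A ^ (p - 1) ≤ 2 / (1 - 2 ^ (1 - p)) := by
  set q : ℝ := 2 ^ (1 - p) with hq
  have hq0 : 0 < q := by positivity
  have hq1 : q < 1 := Real.rpow_lt_one_of_one_lt_of_neg (by norm_num) (by linarith)
  set S : ℕ → ℝ := fun k => τ + 2 * A ^ (1 - p) * ∑ j ∈ Finset.range k, q ^ j with hS
  have hAp : 0 < A ^ (1 - p) := by positivity
  have hmono : ∀ k, S k ≤ S (k + 1) := fun k => by
    simp only [hS, Finset.sum_range_succ]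
    have : 0 ≤ 2 * A ^ (1 - p) * q ^ k := by positivity
    linarith
  have hτS : ∀ k, τ ≤ S k := fun k => by
    have : 0 ≤ 2 * A ^ (1 - p) * ∑ j ∈ Finset.range k, q ^ j := by positivity
    simp only [hS]; linarith
  have step : ∀ k : ℕ, ∀ s, S k ≤ s → τ < s → s < t → ENNReal.ofReal (2 ^ k * A) ≤ f s := by
    intro k
    induction k with
    | zero =>
      intro s _ h₁ h₂
      simpa using le_self_add.trans (hf s h₁ h₂)
    | succ k ih =>
      intro s hs h₁ h₂
      refine le_trans ?_ (hf s h₁ h₂)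
      refine le_trans ?_ le_add_self
      have hB : 0 < 2 ^ k * A := by positivity
      have hgap : 2 * (2 ^ k * A) ^ (1 - p) ≤ s - S k := by
        have e : (2 ^ k * A) ^ (1 - p) = A ^ (1 - p) * q ^ k := by
          rw [Real.mul_rpow (by positivity) hA.le, mul_comm, hq, ← Real.rpow_natCast,
            ← Real.rpow_natCast, ← Real.rpow_mul (by norm_num), ← Real.rpow_mul (by norm_num),
            mul_comm (k : ℝ)]
        rw [e]
        simp only [hS, Finset.sum_range_succ] at hs ⊢
        linarith
      have e2 : (2 : ℝ) ^ (k + 1) * A = (2 ^ k * A) ^ p * (2 * (2 ^ k * A) ^ (1 - p)) := by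
        have : (2 ^ k * A) ^ p * (2 ^ k * A) ^ (1 - p) = 2 ^ k * A := by
          rw [← Real.rpow_add hB, add_sub_cancel, Real.rpow_one]
        rw [pow_succ]
        linear_combination (-2) * this
      calc ENNReal.ofReal (2 ^ (k + 1) * A)
          ≤ ENNReal.ofReal ((2 ^ k * A) ^ p * (s - S k)) := by
            rw [e2]; gcongr
        _ = ∫⁻ r in Ioo (S k) s, ENNReal.ofReal ((2 ^ k * A) ^ p) := by
            rw [setLIntegral_const, Real.volume_Ioo, ENNReal.ofReal_mul (by positivity)]
        _ ≤ ∫⁻ r in Ioo (S k) s, f r ^ p := by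
            refine setLIntegral_mono' measurableSet_Ioo fun r hr => ?_
            rw [← ENNReal.ofReal_rpow_of_nonneg hB.le (by linarith)]
            exact ENNReal.rpow_le_rpow
              (ih r hr.1.le ((hτS k).trans_lt hr.1) (hr.2.trans h₂)) (by linarith)
        _ ≤ ∫⁻ r in Ioo τ s, f r ^ p := lintegral_mono_set (Ioo_subset_Ioo (hτS k) le_rfl)
  by_contra! hcon
  have hq1' : 0 < 1 - q := by linarith
  have hcon' : τ + 2 * A ^ (1 - p) * (1 - q)⁻¹ < t := by
    have h1 : A ^ (p - 1) * A ^ (1 - p) = 1 := by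
      rw [← Real.rpow_add hA]; simp
    have h2 := mul_lt_mul_of_pos_right hcon hAp
    rw [mul_assoc, h1, div_eq_mul_inv] at h2
    linarith
  obtain ⟨s, hs, hst⟩ := exists_between hcon'
  have hSs : ∀ k, S k ≤ s := fun k => by
    have : ∑ j ∈ Finset.range k, q ^ j ≤ (1 - q)⁻¹ :=
      sum_le_hasSum _ (fun j _ => by positivity) (hasSum_geometric_of_lt_one hq0.le hq1)
    have : 2 * A ^ (1 - p) * ∑ j ∈ Finset.range k, q ^ j ≤ 2 * A ^ (1 - p) * (1 - q)⁻¹ := by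
      gcongr
    simp only [hS]; linarith
  have hτs : τ < s := by
    have : 0 < 2 * A ^ (1 - p) * (1 - q)⁻¹ := by positivity
    linarith
  obtain ⟨k, hk⟩ := pow_unbounded_of_one_lt (M / A) (by norm_num : (1 : ℝ) < 2)
  have hk' : M < 2 ^ k * A := (div_lt_iff₀ hA).1 hk
  have := (step k s (hSs k) hτs hst).trans (hM s hτs hst)
  rw [ENNReal.ofReal_le_ofReal_iff'] at this
  rcases this with h | h
  · linarith
  · have : 0 < 2 ^ k * A := by positivity
    linarith

section Euclidean

variable {N : ℕ}

theorem exists_forall_le_of_gaussian_bound {b : ℝ} (hb : b < 1) {Γ : E N → E N → ℝ → ℝ}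
    (hlow : ∃ c₁ c₂ : ℝ, 0 < c₁ ∧ 0 < c₂ ∧ ∀ x y : E N, ∀ t : ℝ, 0 < t →
      ‖y‖ ≤ t ^ (1 / (2 - b)) →
      c₁ * t ^ (-(N : ℝ) / (2 - b)) *
        Real.exp (-c₂ * (‖x - y‖ ^ (2 - b) / t) ^ (1 / (1 - b))) ≤ Γ x y t) :
    ∃ c : ℝ, 0 < c ∧ ∀ x y : E N, ∀ t : ℝ, 0 < t → ‖x‖ ≤ t ^ (1 / (2 - b)) →
      ‖y‖ ≤ t ^ (1 / (2 - b)) → c * t ^ (-(N : ℝ) / (2 - b)) ≤ Γ x y t := by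
  obtain ⟨c₁, c₂, hc₁, hc₂, h⟩ := hlow
  have hb' : 0 < 2 - b := by linarith
  have hb'' : 0 < 1 - b := by linarith
  refine ⟨c₁ * Real.exp (-c₂ * ((2 : ℝ) ^ (2 - b)) ^ (1 / (1 - b))), by positivity,
    fun x y t ht hx hy => le_trans ?_ (h x y t ht hy)⟩
  have hxy : ‖x - y‖ ^ (2 - b) / t ≤ (2 : ℝ) ^ (2 - b) := by
    rw [div_le_iff₀ ht]
    calc ‖x - y‖ ^ (2 - b) ≤ (2 * t ^ (1 / (2 - b))) ^ (2 - b) := by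
          gcongr
          linarith [norm_sub_le x y]
      _ = 2 ^ (2 - b) * t := by
          rw [Real.mul_rpow (by norm_num) (by positivity), ← Real.rpow_mul ht.le,
            one_div_mul_cancel hb'.ne', Real.rpow_one]
  rw [mul_right_comm]
  gcongr _ * Real.exp ?_
  have := Real.rpow_le_rpow (by positivity) hxy (by positivity : 0 ≤ 1 / (1 - b))
  nlinarith

theorem BistochasticSemigroup.ofReal {Γ : E N → E N → ℝ → ℝ}
    (hΓmeas : Measurable (fun q : E N × E N × ℝ => Γ q.1 q.2.1 q.2.2))
    (hΓpos : ∀ x y : E N, ∀ t : ℝ, 0 < t → 0 < Γ x y t)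
    (hK1x : ∀ y : E N, ∀ t : ℝ, 0 < t → ∫ x : E N, Γ x y t = 1)
    (hK1y : ∀ x : E N, ∀ t : ℝ, 0 < t → ∫ y : E N, Γ x y t = 1)
    (hK2 : ∀ x y : E N, ∀ s t : ℝ, 0 < s → s < t →
      Γ x y t = ∫ ξ : E N, Γ x ξ (t - s) * Γ ξ y s) :
    BistochasticSemigroup volume fun x y t => ENNReal.ofReal (Γ x y t) := by
  have key : ∀ (f : E N → ℝ) (a : ℝ), (∀ x, 0 ≤ f x) → 0 < a → ∫ x, f x = a →
      ∫⁻ x, ENNReal.ofReal (f x) = ENNReal.ofReal a := by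
    intro f a hf ha h
    rw [← h, ofReal_integral_eq_lintegral_ofReal _ (Filter.Eventually.of_forall hf)]
    by_contra hi
    exact ha.ne (by rw [← h, integral_undef hi])
  refine ⟨hΓmeas.ennreal_ofReal, fun y t ht => ?_, fun x t ht => ?_, fun x y s t hs hst => ?_⟩
  · simpa using key _ 1 (fun x => (hΓpos x y t ht).le) one_pos (hK1x y t ht)
  · simpa using key _ 1 (fun y => (hΓpos x y t ht).le) one_pos (hK1y x t ht)
  · have h1 : ∀ ξ, 0 < Γ x ξ (t - s) := fun ξ => hΓpos _ _ _ (sub_pos.2 hst)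
    rw [← key _ _ (fun ξ => (mul_pos (h1 ξ) (hΓpos ξ y s hs)).le)
      (hΓpos x y t (hs.trans hst)) (hK2 x y s t hs hst).symm]
    exact lintegral_congr fun ξ => ENNReal.ofReal_mul (h1 ξ).le

theorem DuhamelSolution.ofReal {p : ℝ} (hp : 0 ≤ p) {Γ : E N → E N → ℝ → ℝ}
    (hΓpos : ∀ x y : E N, ∀ t : ℝ, 0 < t → 0 < Γ x y t)
    {φ : E N → ℝ} (hφmeas : Measurable φ) (hφ : ∀ x, 0 ≤ φ x)
    {u : E N → ℝ → ℝ} (hu : IsMildSolution N p Γ φ ⊤ u) :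
    DuhamelSolution volume p (fun x y t => ENNReal.ofReal (Γ x y t))
      (fun x => ENNReal.ofReal (φ x)) (fun x t => ENNReal.ofReal (u x t)) := by
  obtain ⟨hum, hu0, -, hueq⟩ := hu
  refine ⟨hφmeas.ennreal_ofReal, hum.ennreal_ofReal, fun t ht => ?_⟩
  filter_upwards [hueq t ht ENNReal.ofReal_lt_top] with x hx
  obtain ⟨h1, h2, h3⟩ := hx
  have hsrc : ∀ y, ∀ s ∈ Ioo 0 t, 0 ≤ Γ x y (t - s) * u y s ^ p := fun y s hs =>
    mul_nonneg (hΓpos _ _ _ (sub_pos.2 hs.2)).le (Real.rpow_nonneg (hu0 y s) p)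
  have hmem : ∀ᵐ q ∂(volume : Measure (E N)).prod (volume.restrict (Ioo 0 t)),
      q.2 ∈ Ioo 0 t :=
    Measure.quasiMeasurePreserving_snd.ae (ae_restrict_mem measurableSet_Ioo)
  have hnn : 0 ≤ᵐ[(volume : Measure (E N)).prod (volume.restrict (Ioo 0 t))]
      fun q => Γ x q.1 (t - q.2) * u q.1 q.2 ^ p := by
    filter_upwards [hmem] with q hq using hsrc q.1 q.2 hq
  have e2 : ENNReal.ofReal (∫ s in Ioo (0:ℝ) t, ∫ y, Γ x y (t - s) * u y s ^ p) =
      ∫⁻ s in Ioo (0:ℝ) t, ∫⁻ y, ENNReal.ofReal (Γ x y (t - s)) * ENNReal.ofReal (u y s) ^ p := by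
    rw [← integral_prod_symm (fun q : E N × ℝ => Γ x q.1 (t - q.2) * u q.1 q.2 ^ p) h2,
      ofReal_integral_eq_lintegral_ofReal h2 hnn,
      lintegral_prod_symm _ h2.aestronglyMeasurable.aemeasurable.ennreal_ofReal]
    refine setLIntegral_congr_fun measurableSet_Ioo fun s hs => lintegral_congr fun y => ?_
    rw [ENNReal.ofReal_mul (hΓpos _ _ _ (sub_pos.2 hs.2)).le,
      ENNReal.ofReal_rpow_of_nonneg (hu0 y s) hp]
  have h1nn : ∀ y, 0 ≤ Γ x y t * φ y := fun y => mul_nonneg (hΓpos x y t ht).le (hφ y)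
  rw [h3, ENNReal.ofReal_add (integral_nonneg h1nn)
    (setIntegral_nonneg measurableSet_Ioo fun s hs => integral_nonneg fun y => hsrc y s hs), e2,
    ofReal_integral_eq_lintegral_ofReal h1 (Filter.Eventually.of_forall h1nn)]
  congr 1
  exact lintegral_congr fun y => ENNReal.ofReal_mul (hΓpos x y t ht).le

theorem ofReal_le_lintegral_mul {G : E N → E N → ℝ → ℝ≥0∞} {θ c : ℝ} {V : E N → ℝ≥0∞} (hc : 0 < c)
    (hlow : ∀ x y t, 0 < t → ‖x‖ ≤ t ^ θ → ‖y‖ ≤ t ^ θ →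
      ENNReal.ofReal (c * t ^ (-(N * θ))) ≤ G x y t)
    {ρ m : ℝ} (hρ : 0 < ρ)
    (hm : ENNReal.ofReal m ≤ ∫⁻ y in Metric.closedBall 0 (ρ ^ θ), V y)
    {x : E N} (hx : ‖x‖ ≤ ρ ^ θ) :
    ENNReal.ofReal (c * ρ ^ (-(N * θ)) * m) ≤ ∫⁻ y, G x y ρ * V y := by
  calc ENNReal.ofReal (c * ρ ^ (-(N * θ)) * m)
      = ENNReal.ofReal (c * ρ ^ (-(N * θ))) * ENNReal.ofReal m :=
        ENNReal.ofReal_mul (by positivity)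
    _ ≤ ENNReal.ofReal (c * ρ ^ (-(N * θ))) * ∫⁻ y in Metric.closedBall 0 (ρ ^ θ), V y := by
        gcongr
    _ ≤ ∫⁻ y in Metric.closedBall 0 (ρ ^ θ), ENNReal.ofReal (c * ρ ^ (-(N * θ))) * V y :=
        lintegral_const_mul_le _ _
    _ ≤ ∫⁻ y in Metric.closedBall 0 (ρ ^ θ), G x y ρ * V y := by
        refine setLIntegral_mono' Metric.isClosed_closedBall.measurableSet fun y hy => ?_
        gcongr
        exact hlow x y ρ hρ hx (by simpa using hy)
    _ ≤ ∫⁻ y, G x y ρ * V y := setLIntegral_le_lintegral _ _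

theorem iUnion_closedBall_rpow {θ : ℝ} (hθ : 0 < θ) :
    ⋃ n : ℕ, Metric.closedBall (0 : E N) (((n : ℝ) + 1) ^ θ) = univ := by
  refine eq_univ_of_forall fun x => mem_iUnion.2 ?_
  obtain ⟨n, hn⟩ := exists_nat_gt (‖x‖ ^ θ⁻¹)
  refine ⟨n, mem_closedBall_zero_iff.2 ?_⟩
  calc ‖x‖ = (‖x‖ ^ θ⁻¹) ^ θ := (Real.rpow_inv_rpow (norm_nonneg x) hθ.ne').symm
    _ ≤ ((n : ℝ) + 1) ^ θ := by gcongr; linarith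

theorem lintegral_eq_iSup_closedBall_rpow {θ : ℝ} (hθ : 0 < θ) (V : E N → ℝ≥0∞) :
    ∫⁻ y, V y = ⨆ n : ℕ, ∫⁻ y in Metric.closedBall 0 (((n : ℝ) + 1) ^ θ), V y := by
  rw [← setLIntegral_univ, ← iUnion_closedBall_rpow (N := N) hθ]
  refine setLIntegral_iUnion_of_directed _ (Monotone.directed_le fun i j hij => ?_)
  exact Metric.closedBall_subset_closedBall (by gcongr)

theorem volume_closedBall_rpow {θ ρ : ℝ} (hρ : 0 < ρ) :
    volume (Metric.closedBall (0 : E N) (ρ ^ θ)) =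
      ENNReal.ofReal (ρ ^ (N * θ)) * volume (Metric.ball (0 : E N) 1) := by
  rw [Measure.addHaar_closedBall _ _ (by positivity), finrank_euclideanSpace_fin,
    ← Real.rpow_natCast, ← Real.rpow_mul hρ.le, mul_comm θ]

theorem setLIntegral_ofReal_inv_sub {τ a R : ℝ} (ha : 0 < a) (haR : a ≤ R) :
    ∫⁻ r in Ioo (τ + a) (τ + R), ENNReal.ofReal (r - τ)⁻¹ = ENNReal.ofReal (Real.log (R / a)) := by
  have hR : 0 < R := ha.trans_le haR
  have hint : IntervalIntegrable (fun r : ℝ => (r - τ)⁻¹) volume (τ + a) (τ + R) := by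
    refine ContinuousOn.intervalIntegrable fun r hr => ContinuousAt.continuousWithinAt ?_
    rw [uIcc_of_le (by linarith)] at hr
    have h : 0 < r - τ := by linarith [hr.1]
    have : r - τ ≠ 0 := h.ne'
    fun_prop (disch := assumption)
  have e : ∫ r in (τ + a)..(τ + R), (r - τ)⁻¹ = Real.log (R / a) := by
    rw [intervalIntegral.integral_comp_sub_right (fun r => r⁻¹), add_sub_cancel_left,
      add_sub_cancel_left, integral_inv_of_pos ha hR]
  rw [← e, intervalIntegral.integral_of_le (by linarith), ← restrict_Ioo_eq_restrict_Ioc]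
  rw [intervalIntegrable_iff_integrableOn_Ioo_of_le (by linarith)] at hint
  refine (ofReal_integral_eq_lintegral_ofReal hint ?_).symm
  filter_upwards [ae_restrict_mem measurableSet_Ioo] with r hr
  exact inv_nonneg.2 (by linarith [hr.1])

namespace DuhamelSolution

variable {G : E N → E N → ℝ → ℝ≥0∞} {p θ c M : ℝ} {Φ : E N → ℝ≥0∞} {U : E N → ℝ → ℝ≥0∞}

/-- Masses on large balls are bounded, uniformly in time and in the radius. -/
theorem rpow_le_of_ofReal_le_ball_mass (hp : 1 < p) (hθp : N * θ * (p - 1) ≤ 1) (hc : 0 < c)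
    (hG : BistochasticSemigroup volume G)
    (hlow : ∀ x y t, 0 < t → ‖x‖ ≤ t ^ θ → ‖y‖ ≤ t ^ θ →
      ENNReal.ofReal (c * t ^ (-(N * θ))) ≤ G x y t)
    (hU : DuhamelSolution volume p G Φ U)
    (hM : ∀ t, 0 < t → ∀ᵐ x, U x t ≤ ENNReal.ofReal M)
    {τ ρ m : ℝ} (hτ : 0 < τ) (hρ : 1 ≤ ρ) (hm0 : 0 < m)
    (hm : ENNReal.ofReal m ≤ ∫⁻ y in Metric.closedBall 0 (ρ ^ θ), U y τ) :
    (c * m) ^ (p - 1) ≤ 2 / (1 - 2 ^ (1 - p)) := by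
  have hρ0 : 0 < ρ := by linarith
  have hA : ENNReal.ofReal (c * ρ ^ (-(N * θ)) * m) ≤
      ∫⁻ y, G 0 y (τ + ρ - τ) * U y τ := by
    rw [add_sub_cancel_left]
    exact ofReal_le_lintegral_mul hc hlow hρ0 hm (by simpa using by positivity)
  have key := lifespan_mul_rpow_le hp (τ := τ) (t := τ + ρ) (M := M)
    (A := c * ρ ^ (-(N * θ)) * m) (by positivity)
    (f := fun s => ∫⁻ y, G 0 y (τ + ρ - s) * U y s)
    (fun s hs hst => le_trans (by gcongr) (hU.lintegral_mul_add_le hp hG 0 hτ hs hst))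
    (fun s hs hst => by
      calc ∫⁻ y, G 0 y (τ + ρ - s) * U y s
          ≤ ∫⁻ y, G 0 y (τ + ρ - s) * ENNReal.ofReal M := by
            refine lintegral_mono_ae ?_
            filter_upwards [hM s (hτ.trans hs)] with y hy
            gcongr
        _ = ENNReal.ofReal M := by
            rw [lintegral_mul_const _ (hG.measurable_snd _ _),
              hG.lintegral_snd _ _ (by linarith), one_mul])
  refine le_trans ?_ key
  rw [add_sub_cancel_left, mul_right_comm,
    Real.mul_rpow (x := c * m) (by positivity) (by positivity),
    ← Real.rpow_mul hρ0.le, mul_left_comm]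
  refine le_mul_of_one_le_right (by positivity) ?_
  nth_rw 1 [← Real.rpow_one ρ]
  rw [← Real.rpow_add hρ0]
  exact Real.one_le_rpow hρ (by linarith)

theorem exists_mass_le (hθ : 0 < θ) (hp : 1 < p) (hθp : N * θ * (p - 1) ≤ 1) (hc : 0 < c)
    (hG : BistochasticSemigroup volume G)
    (hlow : ∀ x y t, 0 < t → ‖x‖ ≤ t ^ θ → ‖y‖ ≤ t ^ θ →
      ENNReal.ofReal (c * t ^ (-(N * θ))) ≤ G x y t)
    (hU : DuhamelSolution volume p G Φ U)
    (hM : ∀ t, 0 < t → ∀ᵐ x, U x t ≤ ENNReal.ofReal M) :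
    ∃ D : ℝ, ∀ τ, 0 < τ → ∫⁻ y, U y τ ≤ ENNReal.ofReal D := by
  set K : ℝ := 2 / (1 - 2 ^ (1 - p)) with hK
  refine ⟨K ^ (p - 1)⁻¹ / c, fun τ hτ => ?_⟩
  rw [lintegral_eq_iSup_closedBall_rpow hθ]
  refine iSup_le fun n => ?_
  by_contra! hlt
  obtain ⟨m, -, hDm, hm⟩ := ENNReal.lt_iff_exists_real_btwn.1 hlt
  have hDm' := ENNReal.ofReal_lt_ofReal_iff'.1 hDm
  have h := hU.rpow_le_of_ofReal_le_ball_mass hp hθp hc hG hlow hM hτ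
    (by linarith [(Nat.cast_nonneg n : (0 : ℝ) ≤ n)]) hDm'.2 hm.le
  have hcm : 0 < c * m := mul_pos hc hDm'.2
  have h2 := Real.rpow_le_rpow (by positivity) h (by simpa using hp.le : 0 ≤ (p - 1)⁻¹)
  rw [Real.rpow_rpow_inv hcm.le (by linarith)] at h2
  have h3 := (div_lt_iff₀ hc).1 hDm'.1
  linarith

theorem lintegral_eq_zero (hθ : 0 < θ) (hp : 1 < p) (hθp : N * θ * (p - 1) ≤ 1) (hc : 0 < c)
    (hG : BistochasticSemigroup volume G)
    (hlow : ∀ x y t, 0 < t → ‖x‖ ≤ t ^ θ → ‖y‖ ≤ t ^ θ →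
      ENNReal.ofReal (c * t ^ (-(N * θ))) ≤ G x y t)
    (hU : DuhamelSolution volume p G Φ U)
    (hM : ∀ t, 0 < t → ∀ᵐ x, U x t ≤ ENNReal.ofReal M) {τ : ℝ} (hτ : 0 < τ) :
    ∫⁻ y, U y τ = 0 := by
  by_contra! hne
  obtain ⟨D, hD⟩ := hU.exists_mass_le hθ hp hθp hc hG hlow hM
  rw [lintegral_eq_iSup_closedBall_rpow hθ, ← pos_iff_ne_zero, lt_iSup_iff] at hne
  obtain ⟨n, hn⟩ := hne
  set a : ℝ := (n : ℝ) + 1 with ha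
  have ha1 : 1 ≤ a := by linarith [(Nat.cast_nonneg n : (0 : ℝ) ≤ n)]
  obtain ⟨m, -, hm0, hm⟩ := ENNReal.lt_iff_exists_real_btwn.1 hn
  rw [ENNReal.ofReal_pos] at hm0
  set κ : ℝ≥0∞ := ENNReal.ofReal ((c * m) ^ p) * volume (Metric.ball (0 : E N) 1) with hκ
  have hκ0 : κ ≠ 0 := by
    refine mul_ne_zero ?_ (Metric.measure_ball_pos _ _ one_pos).ne'
    rw [Ne, ENNReal.ofReal_eq_zero, not_le]
    positivity
  have source : ∀ r, τ + a < r → κ * ENNReal.ofReal (r - τ)⁻¹ ≤ ∫⁻ x, U x r ^ p := by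
    intro r hr
    set ρ := r - τ with hρ
    have hρa : a < ρ := by linarith
    have hρ0 : 0 < ρ := by linarith
    have hmρ : ENNReal.ofReal m ≤ ∫⁻ y in Metric.closedBall 0 (ρ ^ θ), U y τ :=
      hm.le.trans (lintegral_mono_set (Metric.closedBall_subset_closedBall (by gcongr)))
    have hpt : ∀ᵐ x, x ∈ Metric.closedBall (0 : E N) (ρ ^ θ) →
        ENNReal.ofReal ((c * ρ ^ (-(N * θ)) * m) ^ p) ≤ U x r ^ p := by
      filter_upwards [hU.lintegral_mul_le hG hτ (by linarith : τ < r)] with x hx hxb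
      rw [← ENNReal.ofReal_rpow_of_nonneg (by positivity) (by linarith)]
      refine ENNReal.rpow_le_rpow (le_trans ?_ hx) (by linarith)
      exact ofReal_le_lintegral_mul hc hlow hρ0 hmρ (by simpa using hxb)
    calc κ * ENNReal.ofReal ρ⁻¹
        = ENNReal.ofReal ((c * m) ^ p * ρ⁻¹) * volume (Metric.ball (0 : E N) 1) := by
          rw [hκ, mul_right_comm, ENNReal.ofReal_mul (by positivity)]
      _ ≤ ENNReal.ofReal ((c * ρ ^ (-(N * θ)) * m) ^ p * ρ ^ (N * θ)) *
            volume (Metric.ball (0 : E N) 1) := by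
          gcongr ENNReal.ofReal ?_ * _
          rw [mul_right_comm c, Real.mul_rpow (x := c * m) (by positivity) (by positivity), mul_assoc]
          gcongr _ * ?_
          rw [← Real.rpow_mul hρ0.le, ← Real.rpow_add hρ0, ← Real.rpow_neg_one]
          exact Real.rpow_le_rpow_of_exponent_le (by linarith) (by linarith)
      _ = ∫⁻ x in Metric.closedBall (0 : E N) (ρ ^ θ),
            ENNReal.ofReal ((c * ρ ^ (-(N * θ)) * m) ^ p) := by
          rw [setLIntegral_const, volume_closedBall_rpow hρ0, ENNReal.ofReal_mul (by positivity),
            mul_assoc]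
      _ ≤ ∫⁻ x in Metric.closedBall (0 : E N) (ρ ^ θ), U x r ^ p :=
          setLIntegral_mono_ae' Metric.isClosed_closedBall.measurableSet hpt
      _ ≤ ∫⁻ x, U x r ^ p := setLIntegral_le_lintegral _ _
  obtain ⟨k, hk⟩ := ENNReal.exists_nat_mul_gt hκ0 (ENNReal.ofReal_ne_top (r := D))
  have haR : a ≤ a * Real.exp k :=
    le_mul_of_one_le_right (by linarith) (Real.one_le_exp (Nat.cast_nonneg k))
  refine absurd hk (not_lt.2 ?_)
  calc (k : ℝ≥0∞) * κ
      = κ * ∫⁻ r in Ioo (τ + a) (τ + a * Real.exp k), ENNReal.ofReal (r - τ)⁻¹ := by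
        rw [setLIntegral_ofReal_inv_sub (by linarith) haR,
          mul_div_cancel_left₀ _ (by linarith : a ≠ 0), Real.log_exp, ENNReal.ofReal_natCast,
          mul_comm]
    _ ≤ ∫⁻ r in Ioo (τ + a) (τ + a * Real.exp k), κ * ENNReal.ofReal (r - τ)⁻¹ :=
        lintegral_const_mul_le _ _
    _ ≤ ∫⁻ r in Ioo (τ + a) (τ + a * Real.exp k), ∫⁻ x, U x r ^ p :=
        setLIntegral_mono' measurableSet_Ioo fun r hr => source r hr.1
    _ ≤ ∫⁻ r in Ioo 0 (τ + a * Real.exp k), ∫⁻ x, U x r ^ p :=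
        lintegral_mono_set (Ioo_subset_Ioo (by linarith) le_rfl)
    _ ≤ ∫⁻ x, U x (τ + a * Real.exp k) :=
        hU.lintegral_source_le_mass hG (by positivity)
    _ ≤ ENNReal.ofReal D := hD _ (by positivity)

end DuhamelSolution

end Euclidean

/-- Theorem 1.2: nonexistence of nontrivial global-in-time solutions for
`1 < p ≤ 1 + (2-b)/N`, for any positive kernel satisfying (K1), (K2) and the
lower Gaussian-type bound. -/
theorem no_global_solution_radial_weight
    (N : ℕ) (hN : 1 ≤ N) (b : ℝ) (hb1 : -(N : ℝ) < b) (hb2 : b < 1)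
    (p : ℝ) (hp1 : 1 < p) (hp2 : p ≤ 1 + (2 - b) / N)
    (Γ : E N → E N → ℝ → ℝ)
    (hΓmeas : Measurable (fun q : E N × E N × ℝ => Γ q.1 q.2.1 q.2.2))
    (hΓpos : ∀ x y : E N, ∀ t : ℝ, 0 < t → 0 < Γ x y t)
    (hK1x : ∀ y : E N, ∀ t : ℝ, 0 < t → ∫ x : E N, Γ x y t = 1)
    (hK1y : ∀ x : E N, ∀ t : ℝ, 0 < t → ∫ y : E N, Γ x y t = 1)
    (hK2 : ∀ x y : E N, ∀ s t : ℝ, 0 < s → s < t →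
      Γ x y t = ∫ ξ : E N, Γ x ξ (t - s) * Γ ξ y s)
    (hlow : ∃ c₁ c₂ : ℝ, 0 < c₁ ∧ 0 < c₂ ∧ ∀ x y : E N, ∀ t : ℝ, 0 < t →
      ‖y‖ ≤ t ^ (1 / (2 - b)) →
      c₁ * t ^ (-(N : ℝ) / (2 - b)) *
        Real.exp (-c₂ * (‖x - y‖ ^ (2 - b) / t) ^ (1 / (1 - b))) ≤ Γ x y t)
    (φ : E N → ℝ) (hφmeas : Measurable φ) (hφ : ∀ x, 0 ≤ φ x)
    (u : E N → ℝ → ℝ) (hu : IsMildSolution N p Γ φ ⊤ u) :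
    ∀ᵐ q ∂((volume : Measure (E N)).prod (volume.restrict (Ioi (0:ℝ)))),
      u q.1 q.2 = 0 := by
  obtain ⟨c, hc, hcΓ⟩ := exists_forall_le_of_gaussian_bound hb2 hlow
  have hN' : (0 : ℝ) < N := by exact_mod_cast hN
  have hb' : 0 < 2 - b := by linarith
  have hG := BistochasticSemigroup.ofReal hΓmeas hΓpos hK1x hK1y hK2
  have hU := DuhamelSolution.ofReal (by linarith) hΓpos hφmeas hφ hu
  obtain ⟨M, hM⟩ := hu.2.2.1
  have hθp : (N : ℝ) * (1 / (2 - b)) * (p - 1) ≤ 1 := by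
    have h : p - 1 ≤ (2 - b) / N := by linarith
    calc (N : ℝ) * (1 / (2 - b)) * (p - 1) ≤ N * (1 / (2 - b)) * ((2 - b) / N) := by gcongr
      _ = 1 := by field_simp
  have hzero : ∀ t, 0 < t → ∫⁻ x, ENNReal.ofReal (u x t) = 0 := fun t ht =>
    hU.lintegral_eq_zero (θ := 1 / (2 - b)) (c := c) (M := M) (by positivity) hp1 hθp hc hG
      (fun x y t ht hx hy => by
        have h := hcΓ x y t ht hx hy
        rw [neg_div, div_eq_mul_one_div] at h
        exact ENNReal.ofReal_le_ofReal h)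
      (fun t ht => by
        filter_upwards [hM t ht ENNReal.ofReal_lt_top] with x hx
        exact ENNReal.ofReal_le_ofReal hx) ht
  have hprod : ∫⁻ q, ENNReal.ofReal (u q.1 q.2)
      ∂((volume : Measure (E N)).prod (volume.restrict (Ioi (0:ℝ)))) = 0 := by
    rw [lintegral_prod_symm _ hU.measurable.aemeasurable,
      setLIntegral_congr_fun measurableSet_Ioi fun t ht => hzero t ht, lintegral_zero]
  filter_upwards [(lintegral_eq_zero_iff hU.measurable).1 hprod] with q hq
  exact le_antisymm (ENNReal.ofReal_eq_zero.1 hq) (hu.2.1 _ _)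
end
end

section
/- Let N ≥ 1, let a be a real number with −1 < a < 1 and aN < 2, let p > 1 + (2−a)/N, and set r_* := N(p−1)/(2−a) > 1. Let Γ : ℝ^N × ℝ^N × (0,∞) → ℝ be a measurable nonnegative kernel satisfying (K1), (K2), and the upper Gaussian-type bound: there exist C₀, c₀ > 0 such that Γ(x,y,t) ≤ C₀ t^{−N/(2−a)} exp(−c₀ (|x−y|^{(2−a)}/t)^{1/(1−a)}) for all x, y ∈ ℝ^N and t > 0. Then there exists δ > 0 such that for every nonnegative φ ∈ L^∞(ℝ^N) with ‖φ‖_{r_*,∞} < δ, there exists a global-in-time mild solution u of u_t = div(w∇u) + u^p with kernel Γ and initial data φ, and it satisfies sup_{t>0} (1+t)^{(N/(2−a))(1/r_* − 1/q)} ‖u(·,t)‖_{q,∞} < ∞ for every q with r_* ≤ q ≤ ∞. -/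
open MeasureTheory Real Set
open scoped ENNReal

noncomputable section

section WeakLebesgue

variable {X : Type*} [MeasurableSpace X] {μ : Measure X}

/-- Tail integral of a function in weak `L^r`, `r > 1`. -/
theorem lintegral_ofReal_sub_le_of_weak {ψ : X → ℝ} (hψ : Measurable ψ) {B r k : ℝ}
    (hB : 0 ≤ B) (hr : 1 < r) (hk : 0 < k)
    (h : ∀ l : ℝ, 0 < l → μ {x | l < ψ x} ≤ ENNReal.ofReal (B * l ^ (-r))) :
    ∫⁻ x, ENNReal.ofReal (ψ x - k) ∂μ ≤ ENNReal.ofReal (B * (k ^ (1 - r) / (r - 1))) := by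
  have hmax : ∀ x, ENNReal.ofReal (ψ x - k) = ENNReal.ofReal (max (ψ x - k) 0) := fun x => by
    rcases le_total (ψ x - k) 0 with h0 | h0
    · simp [h0]
    · rw [max_eq_left h0]
  simp_rw [hmax]
  rw [lintegral_eq_lintegral_meas_lt (f := fun x => max (ψ x - k) 0) μ
    (Filter.Eventually.of_forall fun x => le_max_right _ _)
    ((hψ.sub_const k).max measurable_const).aemeasurable]
  have hint : IntegrableOn (fun l : ℝ => B * l ^ (-r)) (Ioi k) :=
    (integrableOn_Ioi_rpow_of_lt (by linarith) hk).const_mul B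
  calc ∫⁻ l in Ioi (0 : ℝ), μ {x | l < max (ψ x - k) 0}
      ≤ ∫⁻ l in Ioi (0 : ℝ), ENNReal.ofReal (B * (l + k) ^ (-r)) := by
        refine setLIntegral_mono' measurableSet_Ioi fun l hl => ?_
        have hl : 0 < l := hl
        refine (measure_mono fun x hx => ?_).trans (h (l + k) (by linarith))
        simp only [mem_ofPred_eq, lt_max_iff] at hx ⊢
        rcases hx with hx | hx <;> linarith
    _ = ∫⁻ l in Ioi k, ENNReal.ofReal (B * l ^ (-r)) := by
        have := (measurePreserving_add_right (volume : Measure ℝ) k).setLIntegral_comp_preimage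
          (s := Ioi k) measurableSet_Ioi
          (f := fun l => ENNReal.ofReal (B * l ^ (-r))) (by fun_prop)
        simpa using this
    _ = ENNReal.ofReal (B * (k ^ (1 - r) / (r - 1))) := by
        rw [← ofReal_integral_eq_lintegral_ofReal hint, integral_const_mul,
          integral_Ioi_rpow_of_lt (by linarith) hk]
        · congr 2
          rw [show -r + 1 = -(r - 1) by ring, neg_div_neg_eq, neg_sub]
        · refine (ae_restrict_iff' measurableSet_Ioi).2 (Filter.Eventually.of_forall fun l hl => ?_)
          have : 0 < l := hk.trans hl
          simp only [Pi.zero_apply]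
          positivity

theorem lintegral_mul_ofReal_le_add {g : X → ℝ≥0∞} (hg : Measurable g)
    (h1 : ∫⁻ y, g y ∂μ = 1) (ψ : X → ℝ) (k : ℝ) :
    ∫⁻ y, g y * ENNReal.ofReal (ψ y) ∂μ
      ≤ ENNReal.ofReal k + ∫⁻ y, g y * ENNReal.ofReal (ψ y - k) ∂μ := by
  calc ∫⁻ y, g y * ENNReal.ofReal (ψ y) ∂μ
      ≤ ∫⁻ y, (g y * ENNReal.ofReal k + g y * ENNReal.ofReal (ψ y - k)) ∂μ := by
        refine lintegral_mono fun y => ?_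
        rw [← mul_add]
        gcongr
        calc ENNReal.ofReal (ψ y) = ENNReal.ofReal (k + (ψ y - k)) := by ring_nf
          _ ≤ _ := ENNReal.ofReal_add_le
    _ = _ := by
        rw [lintegral_add_left (hg.mul_const _), lintegral_mul_const _ hg, h1, one_mul]

/-- `L^∞` smoothing of a probability density bounded by `D`, on weak `L^r`. -/
theorem lintegral_mul_ofReal_le_of_weak {g : X → ℝ≥0∞} (hg : Measurable g)
    (h1 : ∫⁻ y, g y ∂μ = 1) {D : ℝ} (hD : 0 ≤ D) (hgD : ∀ y, g y ≤ ENNReal.ofReal D)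
    {ψ : X → ℝ} (hψ : Measurable ψ) {B r k : ℝ}
    (hB : 0 ≤ B) (hr : 1 < r) (hk : 0 < k)
    (h : ∀ l : ℝ, 0 < l → μ {x | l < ψ x} ≤ ENNReal.ofReal (B * l ^ (-r))) :
    ∫⁻ y, g y * ENNReal.ofReal (ψ y) ∂μ
      ≤ ENNReal.ofReal (k + D * (B * (k ^ (1 - r) / (r - 1)))) := by
  have hr' : 0 < r - 1 := by linarith
  refine (lintegral_mul_ofReal_le_add hg h1 ψ k).trans ?_
  rw [ENNReal.ofReal_add hk.le (by positivity), ENNReal.ofReal_mul hD]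
  gcongr
  calc ∫⁻ y, g y * ENNReal.ofReal (ψ y - k) ∂μ
      ≤ ∫⁻ y, ENNReal.ofReal D * ENNReal.ofReal (ψ y - k) ∂μ :=
        lintegral_mono fun y => mul_le_mul_left (hgD y) _
    _ = ENNReal.ofReal D * ∫⁻ y, ENNReal.ofReal (ψ y - k) ∂μ :=
        lintegral_const_mul _ (hψ.sub_const k).ennreal_ofReal
    _ ≤ _ := by gcongr; exact lintegral_ofReal_sub_le_of_weak hψ hB hr hk h

/-- A doubly stochastic kernel is bounded on weak `L^r`, `r > 1`. -/
theorem meas_lintegral_mul_ofReal_le_of_weak [SFinite μ] {g : X → X → ℝ≥0∞}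
    (hg : Measurable (Function.uncurry g))
    (h1x : ∀ y, ∫⁻ x, g x y ∂μ = 1) (h1y : ∀ x, ∫⁻ y, g x y ∂μ = 1)
    {ψ : X → ℝ} (hψ : Measurable ψ) {B r l : ℝ}
    (hB : 0 ≤ B) (hr : 1 < r) (hl : 0 < l)
    (h : ∀ l : ℝ, 0 < l → μ {x | l < ψ x} ≤ ENNReal.ofReal (B * l ^ (-r))) :
    μ {x | ENNReal.ofReal l < ∫⁻ y, g x y * ENNReal.ofReal (ψ y) ∂μ}
      ≤ ENNReal.ofReal (2 ^ r / (r - 1) * B * l ^ (-r)) := by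
  have hl2 : 0 < l / 2 := by linarith
  set F : X → ℝ≥0∞ := fun x => ∫⁻ y, g x y * ENNReal.ofReal (ψ y - l / 2) ∂μ with hF
  have hm : Measurable (Function.uncurry fun x y => g x y * ENNReal.ofReal (ψ y - l / 2)) :=
    hg.mul ((hψ.comp measurable_snd).sub_const _).ennreal_ofReal
  have hsub : {x | ENNReal.ofReal l < ∫⁻ y, g x y * ENNReal.ofReal (ψ y) ∂μ}
      ⊆ {x | ENNReal.ofReal (l / 2) ≤ F x} := fun x hx => by
    by_contra hcon
    simp only [mem_ofPred_eq, not_le] at hx hcon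
    have h2 := hx.trans_le (lintegral_mul_ofReal_le_add (hg.of_uncurry_left (x := x)) (h1y x) ψ
      (l / 2))
    have h3 : ENNReal.ofReal l = ENNReal.ofReal (l / 2) + ENNReal.ofReal (l / 2) := by
      rw [← ENNReal.ofReal_add hl2.le hl2.le]; ring_nf
    rw [h3] at h2
    exact absurd h2 (not_lt.2 (add_le_add le_rfl hcon.le))
  refine (measure_mono hsub).trans ?_
  have hmarkov := mul_meas_ge_le_lintegral (μ := μ) (hm.lintegral_prod_right' (ν := μ))
    (ENNReal.ofReal (l / 2))
  have hFint : ∫⁻ x, F x ∂μ ≤ ENNReal.ofReal (B * ((l / 2) ^ (1 - r) / (r - 1))) := by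
    calc ∫⁻ x, F x ∂μ = ∫⁻ y, ∫⁻ x, g x y * ENNReal.ofReal (ψ y - l / 2) ∂μ ∂μ :=
          lintegral_lintegral_swap hm.aemeasurable
      _ = ∫⁻ y, ENNReal.ofReal (ψ y - l / 2) ∂μ := by
          refine lintegral_congr fun y => ?_
          rw [lintegral_mul_const _ hg.of_uncurry_right, h1x, one_mul]
      _ ≤ _ := lintegral_ofReal_sub_le_of_weak hψ hB hr hl2 h
  have hpos : ENNReal.ofReal (l / 2) ≠ 0 := by simpa using hl
  have hkey : μ {x | ENNReal.ofReal (l / 2) ≤ F x}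
      ≤ ENNReal.ofReal (B * ((l / 2) ^ (1 - r) / (r - 1))) / ENNReal.ofReal (l / 2) := by
    rw [ENNReal.le_div_iff_mul_le (Or.inl hpos) (Or.inl ENNReal.ofReal_ne_top), mul_comm]
    exact hmarkov.trans hFint
  refine hkey.trans_eq ?_
  rw [← ENNReal.ofReal_div_of_pos hl2]
  congr 1
  have hr' : r - 1 ≠ 0 := by linarith
  have e1 : (l / 2) ^ (1 - r) = (l / 2) * (l / 2) ^ (-r) := by
    rw [sub_eq_add_neg, Real.rpow_add hl2, Real.rpow_one]
  have e2 : (l / 2) ^ (-r) = 2 ^ r * l ^ (-r) := by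
    rw [Real.div_rpow hl.le (by norm_num), Real.rpow_neg (by norm_num : (0:ℝ) ≤ 2), div_inv_eq_mul,
      mul_comm]
  rw [e1, e2]
  field_simp

/-- Jensen's inequality for a probability density. -/
theorem lintegral_mul_le_rpow_lintegral_mul_rpow {g f : X → ℝ≥0∞} (hg : Measurable g)
    (hf : Measurable f) (h1 : ∫⁻ y, g y ∂μ = 1) (hgt : ∀ y, g y ≠ ⊤) {α : ℝ} (hα : 1 < α) :
    ∫⁻ y, g y * f y ∂μ ≤ (∫⁻ y, g y * f y ^ α ∂μ) ^ (1 / α) := by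
  have hα0 : 0 < α := by linarith
  have hle : 1 / α ≤ 1 := by rw [div_le_one hα0]; exact hα.le
  have := ENNReal.lintegral_mul_norm_pow_le (μ := μ) (f := fun y => g y * f y ^ α) (g := g)
    (p := 1 / α) (q := 1 - 1 / α) (by fun_prop) hg.aemeasurable (by positivity)
    (by linarith) (by ring)
  rw [h1, ENNReal.one_rpow, mul_one] at this
  refine le_trans (lintegral_mono fun y => le_of_eq ?_) this
  dsimp only
  rw [ENNReal.mul_rpow_of_nonneg _ _ (by positivity), ← ENNReal.rpow_mul,
    mul_one_div_cancel hα0.ne', ENNReal.rpow_one, mul_right_comm]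
  congr 1
  by_cases h0 : g y = 0
  · rw [h0, ENNReal.zero_rpow_of_pos (by positivity), zero_mul]
  · rw [← ENNReal.rpow_add _ _ h0 (hgt y)]
    simp

end WeakLebesgue

/-- Integral of an integrable power at the origin. -/
theorem lintegral_Ioo_rpow {b t : ℝ} (hb : 0 < b) (ht : 0 < t) :
    ∫⁻ s in Ioo (0 : ℝ) t, ENNReal.ofReal (s ^ (b - 1)) = ENNReal.ofReal (t ^ b / b) := by
  have hi : IntervalIntegrable (fun s : ℝ => s ^ (b - 1)) volume 0 t :=
    intervalIntegral.intervalIntegrable_rpow' (by linarith)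
  rw [restrict_Ioo_eq_restrict_Ioc, ← ofReal_integral_eq_lintegral_ofReal hi.1,
    ← intervalIntegral.integral_of_le ht.le, integral_rpow (Or.inl (by linarith))]
  · simp [Real.zero_rpow hb.ne']
  · refine (ae_restrict_iff' measurableSet_Ioc).2 (Filter.Eventually.of_forall fun s hs => ?_)
    exact Real.rpow_nonneg hs.1.le _

section Duhamel

variable {X : Type*} [MeasurableSpace X]

/-- The action of the kernel `G` at time `t` on a function. -/
def kernelFlow (μ : Measure X) (G : X → X → ℝ → ℝ≥0∞) (f : X → ℝ≥0∞) (z : X × ℝ) : ℝ≥0∞ :=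
  ∫⁻ y, G z.1 y z.2 * f y ∂μ

/-- The Duhamel operator `v ↦ S(t) f + ∫₀ᵗ S(t - s) v(s)^p ds`. -/
def duhamelMap (μ : Measure X) (G : X → X → ℝ → ℝ≥0∞) (p : ℝ) (f : X → ℝ≥0∞)
    (v : X × ℝ → ℝ≥0∞) (z : X × ℝ) : ℝ≥0∞ :=
  kernelFlow μ G f z +
    ∫⁻ s in Ioo (0 : ℝ) z.2, kernelFlow μ G (fun y => v (y, s) ^ p) (z.1, z.2 - s)

variable {μ : Measure X} {G : X → X → ℝ → ℝ≥0∞} {p : ℝ} {f : X → ℝ≥0∞}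

theorem measurable_kernelFlow [SFinite μ] (hG : Measurable fun q : X × X × ℝ => G q.1 q.2.1 q.2.2)
    (hf : Measurable f) : Measurable (kernelFlow μ G f) := by
  have : Measurable fun w : (X × ℝ) × X => G w.1.1 w.2 w.1.2 * f w.2 :=
    (hG.comp (f := fun w : (X × ℝ) × X => (w.1.1, w.2, w.1.2)) (by fun_prop)).mul (by fun_prop)
  exact this.lintegral_prod_right'

theorem measurable_kernelFlow_source [SFinite μ]
    (hG : Measurable fun q : X × X × ℝ => G q.1 q.2.1 q.2.2)
    {v : X × ℝ → ℝ≥0∞} (hv : Measurable v) :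
    Measurable fun w : (X × ℝ) × ℝ =>
      kernelFlow μ G (fun y => v (y, w.2) ^ p) (w.1.1, w.1.2 - w.2) := by
  have : Measurable fun w : ((X × ℝ) × ℝ) × X =>
      G w.1.1.1 w.2 (w.1.1.2 - w.1.2) * v (w.2, w.1.2) ^ p :=
    (hG.comp (f := fun w : ((X × ℝ) × ℝ) × X => (w.1.1.1, w.2, w.1.1.2 - w.1.2))
      (by fun_prop)).mul (by fun_prop)
  exact this.lintegral_prod_right'

theorem measurable_duhamelMap [SFinite μ]
    (hG : Measurable fun q : X × X × ℝ => G q.1 q.2.1 q.2.2)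
    (hf : Measurable f) {v : X × ℝ → ℝ≥0∞} (hv : Measurable v) :
    Measurable (duhamelMap μ G p f v) := by
  refine (measurable_kernelFlow hG hf).add ?_
  have hS : MeasurableSet {w : (X × ℝ) × ℝ | 0 < w.2 ∧ w.2 < w.1.2} :=
    (measurableSet_lt measurable_const measurable_snd).inter
      (measurableSet_lt measurable_snd (by fun_prop))
  have := ((measurable_kernelFlow_source (p := p) (μ := μ) hG hv).indicator hS).lintegral_prod_right'
    (ν := (volume : Measure ℝ))
  convert this using 2 with z
  rw [← lintegral_indicator measurableSet_Ioo]
  rfl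

theorem duhamelMap_mono (hp : 0 ≤ p) {v v' : X × ℝ → ℝ≥0∞}
    (h : ∀ x t, 0 < t → v (x, t) ≤ v' (x, t)) (z : X × ℝ) :
    duhamelMap μ G p f v z ≤ duhamelMap μ G p f v' z := by
  refine add_le_add le_rfl (setLIntegral_mono' measurableSet_Ioo fun s hs => ?_)
  exact lintegral_mono fun y => mul_le_mul_right (ENNReal.rpow_le_rpow (h y s hs.1) hp) _

theorem duhamelMap_iSup [SFinite μ] (hp : 0 < p)
    (hG : Measurable fun q : X × X × ℝ => G q.1 q.2.1 q.2.2)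
    {v : ℕ → X × ℝ → ℝ≥0∞} (hv : ∀ n, Measurable (v n)) (hmono : Monotone v) (z : X × ℝ) :
    duhamelMap μ G p f (fun w => ⨆ n, v n w) z = ⨆ n, duhamelMap μ G p f (v n) z := by
  have hflow : ∀ s, kernelFlow μ G (fun y => (⨆ n, v n (y, s)) ^ p) (z.1, z.2 - s)
      = ⨆ n, kernelFlow μ G (fun y => v n (y, s) ^ p) (z.1, z.2 - s) := fun s => by
    unfold kernelFlow
    rw [← lintegral_iSup]
    · refine lintegral_congr fun y => ?_
      have := (ENNReal.orderIsoRpow p hp).map_iSup fun n => v n (y, s)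
      simp only [ENNReal.orderIsoRpow_apply] at this
      dsimp only
      rw [this, ENNReal.mul_iSup]
    · intro n
      have h1 := hG.comp (f := fun y : X => (z.1, y, z.2 - s)) (by fun_prop)
      exact h1.mul (((hv n).comp (by fun_prop : Measurable fun y : X => (y, s))).pow_const p)
    · intro m n hmn y
      exact mul_le_mul_right (ENNReal.rpow_le_rpow (hmono hmn _) hp.le) _
  unfold duhamelMap
  rw [← ENNReal.add_iSup]
  congr 1
  simp_rw [hflow]
  refine lintegral_iSup (fun n => ?_) fun m n hmn s => ?_
  · exact (measurable_kernelFlow_source (p := p) (μ := μ) hG (hv n)).comp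
      (by fun_prop : Measurable fun s : ℝ => (z, s))
  · exact lintegral_mono fun y => mul_le_mul_right (ENNReal.rpow_le_rpow (hmono hmn _) hp.le) _

/-- Monotone iteration below a supersolution yields a solution. -/
theorem exists_duhamelMap_fixed_of_supersolution [SFinite μ] (hp : 0 < p)
    (hG : Measurable fun q : X × X × ℝ => G q.1 q.2.1 q.2.2) (hf : Measurable f)
    {w : X × ℝ → ℝ≥0∞} (hw : ∀ x t, 0 < t → duhamelMap μ G p f w (x, t) ≤ w (x, t)) :
    ∃ u : X × ℝ → ℝ≥0∞, Measurable u ∧ (∀ z, duhamelMap μ G p f u z = u z) ∧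
      ∀ x t, 0 < t → u (x, t) ≤ w (x, t) := by
  set v : ℕ → X × ℝ → ℝ≥0∞ := fun n => (duhamelMap μ G p f)^[n] 0 with hvdef
  have hsucc : ∀ n, v (n + 1) = duhamelMap μ G p f (v n) := fun n =>
    Function.iterate_succ_apply' _ _ _
  have hv : ∀ n, Measurable (v n) := fun n => by
    induction n with
    | zero => exact measurable_const
    | succ n ih => rw [hsucc]; exact measurable_duhamelMap hG hf ih
  have hstep : ∀ n, v n ≤ v (n + 1) := fun n => by
    induction n with
    | zero => exact fun z => zero_le
    | succ n ih =>
      rw [hsucc n, hsucc (n + 1)]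
      exact fun z => duhamelMap_mono hp.le (fun x t _ => ih (x, t)) z
  have hmono : Monotone v := monotone_nat_of_le_succ hstep
  have hle : ∀ n x t, 0 < t → v n (x, t) ≤ w (x, t) := fun n => by
    induction n with
    | zero => exact fun x t _ => zero_le
    | succ n ih =>
      intro x t ht
      rw [hsucc]
      exact (duhamelMap_mono hp.le ih _).trans (hw x t ht)
  refine ⟨fun z => ⨆ n, v n z, Measurable.iSup hv, fun z => ?_,
    fun x t ht => iSup_le fun n => hle n x t ht⟩
  rw [duhamelMap_iSup hp hG hv hmono]
  simp_rw [← hsucc]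
  exact Monotone.iSup_nat_add (f := fun n => v n z) (fun m n hmn => hmono hmn z) 1

/-- The semigroup property on nonnegative functions. -/
theorem kernelFlow_kernelFlow [SFinite μ]
    (hG : Measurable fun q : X × X × ℝ => G q.1 q.2.1 q.2.2)
    (hK : ∀ x y s t, 0 < s → s < t → G x y t = ∫⁻ ξ, G x ξ (t - s) * G ξ y s ∂μ)
    (hf : Measurable f) (x : X) {s t : ℝ} (hs : 0 < s) (hst : s < t) :
    kernelFlow μ G (fun ξ => kernelFlow μ G f (ξ, s)) (x, t - s) = kernelFlow μ G f (x, t) := by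
  have hm1 : Measurable fun ξ => G x ξ (t - s) :=
    hG.comp (f := fun ξ : X => (x, ξ, t - s)) (by fun_prop)
  have hm2 : Measurable fun q : X × X => G q.1 q.2 s :=
    hG.comp (f := fun q : X × X => (q.1, q.2, s)) (by fun_prop)
  unfold kernelFlow
  dsimp only
  calc ∫⁻ ξ, G x ξ (t - s) * ∫⁻ y, G ξ y s * f y ∂μ ∂μ
      = ∫⁻ ξ, ∫⁻ y, G x ξ (t - s) * (G ξ y s * f y) ∂μ ∂μ := by
        refine lintegral_congr fun ξ => (lintegral_const_mul _ ?_).symm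
        exact (hm2.comp (by fun_prop : Measurable fun y : X => (ξ, y))).mul hf
    _ = ∫⁻ y, ∫⁻ ξ, G x ξ (t - s) * (G ξ y s * f y) ∂μ ∂μ := by
        refine lintegral_lintegral_swap (Measurable.aemeasurable ?_)
        exact (hm1.comp measurable_fst).mul (hm2.mul (hf.comp measurable_snd))
    _ = ∫⁻ y, G x y t * f y ∂μ := by
        refine lintegral_congr fun y => ?_
        rw [hK x y s t hs hst, ← lintegral_mul_const]
        · simp_rw [mul_assoc]
        · exact hm1.mul (hm2.comp (by fun_prop : Measurable fun ξ : X => (ξ, y)))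

theorem kernelFlow_le_of_le (hG1 : ∀ x t, 0 < t → ∫⁻ y, G x y t ∂μ = 1)
    (hG : Measurable fun q : X × X × ℝ => G q.1 q.2.1 q.2.2)
    {M : ℝ≥0∞} (hM : ∀ᵐ y ∂μ, f y ≤ M) (x : X) {t : ℝ} (ht : 0 < t) :
    kernelFlow μ G f (x, t) ≤ M := by
  have hm1 : Measurable fun ξ => G x ξ t :=
    hG.comp (f := fun ξ : X => (x, ξ, t)) (by fun_prop)
  calc kernelFlow μ G f (x, t) ≤ ∫⁻ y, G x y t * M ∂μ :=
        lintegral_mono_ae (hM.mono fun y hy => mul_le_mul_right hy _)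
    _ = M := by rw [lintegral_mul_const _ hm1, hG1 x t ht, one_mul]

end Duhamel

section Supersolution

variable {X : Type*} [MeasurableSpace X] {μ : Measure X} {G : X → X → ℝ → ℝ≥0∞}

/-- If `V = S(t) f^α` decays like `(A t^{-1/(p-1)})^α` with `A` small, then `2 V^{1/α}` is a
supersolution. -/
theorem duhamelMap_le_of_decay [SFinite μ]
    (hG : Measurable fun q : X × X × ℝ => G q.1 q.2.1 q.2.2) (hGt : ∀ x y t, G x y t ≠ ⊤)
    (hG1 : ∀ x t, 0 < t → ∫⁻ y, G x y t ∂μ = 1)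
    (hK : ∀ x y s t, 0 < s → s < t → G x y t = ∫⁻ ξ, G x ξ (t - s) * G ξ y s ∂μ)
    {p α A : ℝ} (hα : 1 < α) (hαp : α < p) (hA : 0 < A)
    (hsmall : 2 ^ p * A ^ (p - 1) * ((p - 1) / (α - 1)) ≤ 1)
    {f : X → ℝ≥0∞} (hf : Measurable f)
    (hV : ∀ x t, 0 < t → kernelFlow μ G (fun y => f y ^ α) (x, t)
      ≤ ENNReal.ofReal (A * t ^ (-1 / (p - 1))) ^ α) (x : X) {t : ℝ} (ht : 0 < t) :
    duhamelMap μ G p f (fun z => 2 * kernelFlow μ G (fun y => f y ^ α) z ^ (1 / α)) (x, t)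
      ≤ 2 * kernelFlow μ G (fun y => f y ^ α) (x, t) ^ (1 / α) := by
  have hα0 : 0 < α := by linarith
  have hp1 : 0 < p - 1 := by linarith
  have hα1 : 0 < α - 1 := by linarith
  have hpα : 0 < p - α := by linarith
  set V := kernelFlow μ G (fun y => f y ^ α) with hVdef
  set b := (α - 1) / (p - 1) with hb
  have hb0 : 0 < b := by positivity
  have hVm : Measurable V := measurable_kernelFlow hG (hf.pow_const α)
  have hfirst : kernelFlow μ G f (x, t) ≤ V (x, t) ^ (1 / α) :=
    lintegral_mul_le_rpow_lintegral_mul_rpow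
      (hG.comp (f := fun y : X => (x, y, t)) (by fun_prop)) hf (hG1 x t ht)
      (fun y => hGt x y t) hα
  have hpow : ∀ y s, 0 < s → (2 * V (y, s) ^ (1 / α)) ^ p
      ≤ ENNReal.ofReal (2 ^ p * A ^ (p - α) * s ^ (b - 1)) * V (y, s) := fun y s hs => by
    have h1 : (V (y, s) ^ (1 / α)) ^ p = V (y, s) ^ ((p - α) / α) * V (y, s) := by
      rw [← ENNReal.rpow_mul]
      nth_rewrite 3 [← ENNReal.rpow_one (V (y, s))]
      rw [← ENNReal.rpow_add_of_nonneg _ _ (by positivity) zero_le_one]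
      congr 1
      field_simp
      ring
    have h2 : V (y, s) ^ ((p - α) / α) ≤ ENNReal.ofReal (A ^ (p - α) * s ^ (b - 1)) := by
      refine (ENNReal.rpow_le_rpow (hV y s hs) (by positivity)).trans_eq ?_
      rw [← ENNReal.rpow_mul, mul_div_cancel₀ _ hα0.ne',
        ENNReal.ofReal_rpow_of_nonneg (by positivity) hpα.le,
        Real.mul_rpow hA.le (by positivity), ← Real.rpow_mul hs.le]
      congr 3
      rw [hb]
      field_simp
      ring
    rw [ENNReal.mul_rpow_of_nonneg _ _ (by linarith), h1, ← mul_assoc, mul_assoc (2 ^ p : ℝ),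
      ENNReal.ofReal_mul (by positivity)]
    gcongr
    rw [← ENNReal.ofReal_rpow_of_nonneg (by norm_num) (by linarith)]
    simp
  have hsource : ∫⁻ s in Ioo (0 : ℝ) t,
      kernelFlow μ G (fun y => (2 * V (y, s) ^ (1 / α)) ^ p) (x, t - s)
      ≤ ENNReal.ofReal (2 ^ p * A ^ (p - α)) * ENNReal.ofReal (t ^ b / b) * V (x, t) := by
    calc _ ≤ ∫⁻ s in Ioo (0 : ℝ) t,
          ENNReal.ofReal (2 ^ p * A ^ (p - α)) * ENNReal.ofReal (s ^ (b - 1)) * V (x, t) := by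
          refine setLIntegral_mono' measurableSet_Ioo fun s hs => ?_
          rw [hVdef, ← kernelFlow_kernelFlow hG hK (hf.pow_const α) x hs.1 hs.2, ← hVdef,
            ← ENNReal.ofReal_mul (by positivity)]
          unfold kernelFlow
          dsimp only
          have hm : Measurable fun ξ => G x ξ (t - s) * V (ξ, s) :=
            (hG.comp (f := fun ξ : X => (x, ξ, t - s)) (by fun_prop)).mul (by fun_prop)
          rw [← lintegral_const_mul _ hm]
          refine lintegral_mono fun y => ?_
          rw [mul_left_comm]
          exact mul_le_mul_right (hpow y s hs.1) _
      _ = _ := by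
          rw [lintegral_mul_const _ (by fun_prop), lintegral_const_mul _ (by fun_prop),
            lintegral_Ioo_rpow hb0 ht]
  have hVsplit : V (x, t)
      ≤ ENNReal.ofReal (A ^ (α - 1) * t ^ (-b)) * V (x, t) ^ (1 / α) := by
    have h1 : V (x, t) = V (x, t) ^ ((α - 1) / α) * V (x, t) ^ (1 / α) := by
      rw [← ENNReal.rpow_add_of_nonneg _ _ (by positivity) (by positivity), ← add_div,
        sub_add_cancel, div_self hα0.ne', ENNReal.rpow_one]
    have h2 : V (x, t) ^ ((α - 1) / α) ≤ ENNReal.ofReal (A ^ (α - 1) * t ^ (-b)) := by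
      refine (ENNReal.rpow_le_rpow (hV x t ht) (by positivity)).trans_eq ?_
      rw [← ENNReal.rpow_mul, mul_div_cancel₀ _ hα0.ne',
        ENNReal.ofReal_rpow_of_nonneg (by positivity) hα1.le,
        Real.mul_rpow hA.le (by positivity), ← Real.rpow_mul ht.le]
      congr 3
      rw [hb]
      ring
    calc V (x, t) = _ := h1
      _ ≤ _ := mul_le_mul_left h2 _
  rw [two_mul]
  refine add_le_add hfirst (hsource.trans ?_)
  calc _ ≤ ENNReal.ofReal (2 ^ p * A ^ (p - α)) * ENNReal.ofReal (t ^ b / b) *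
        (ENNReal.ofReal (A ^ (α - 1) * t ^ (-b)) * V (x, t) ^ (1 / α)) :=
        mul_le_mul_right hVsplit _
    _ = ENNReal.ofReal (2 ^ p * A ^ (p - 1) * ((p - 1) / (α - 1))) * V (x, t) ^ (1 / α) := by
        rw [← mul_assoc, ← ENNReal.ofReal_mul (by positivity), ← ENNReal.ofReal_mul (by positivity)]
        congr 2
        have e1 : A ^ (p - 1) = A ^ (p - α) * A ^ (α - 1) := by
          rw [← Real.rpow_add hA]; ring_nf
        have e2 : t ^ b * t ^ (-b) = 1 := by
          rw [← Real.rpow_add ht, add_neg_cancel, Real.rpow_zero]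
        have e3 : (p - 1) / (α - 1) = 1 / b := by rw [hb, one_div_div]
        rw [e1, e3]
        calc _ = 2 ^ p * (A ^ (p - α) * A ^ (α - 1)) * (1 / b) * (t ^ b * t ^ (-b)) := by ring
          _ = _ := by rw [e2, mul_one]
    _ ≤ V (x, t) ^ (1 / α) := by
        calc _ ≤ 1 * V (x, t) ^ (1 / α) :=
              mul_le_mul_left (ENNReal.ofReal_le_one.2 hsmall) _
          _ = _ := one_mul _

/-- Decay of `S(t) φ^α` for `φ` of size `δ` in weak `L^ρ`, where `ρ = θ (p - 1)` is the critical
exponent of a kernel bounded by `C₀ t^{-θ}`. -/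
theorem kernelFlow_rpow_le_of_weak
    (hG : Measurable fun q : X × X × ℝ => G q.1 q.2.1 q.2.2)
    (hG1 : ∀ x t, 0 < t → ∫⁻ y, G x y t ∂μ = 1)
    {C₀ θ : ℝ} (hC₀ : 0 ≤ C₀)
    (hGb : ∀ x y t, 0 < t → G x y t ≤ ENNReal.ofReal (C₀ * t ^ (-θ)))
    {p α ρ δ : ℝ} (hp : 1 < p) (hρ : ρ = θ * (p - 1)) (hα : 0 < α) (hαρ : α < ρ) (hδ : 0 < δ)
    {ψ : X → ℝ} (hψ : Measurable ψ)
    (h : ∀ l : ℝ, 0 < l → μ {x | l < ψ x} ≤ ENNReal.ofReal (δ ^ ρ * l ^ (-(ρ / α))))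
    (x : X) {t : ℝ} (ht : 0 < t) :
    kernelFlow μ G (fun y => ENNReal.ofReal (ψ y)) (x, t)
      ≤ ENNReal.ofReal ((1 + C₀ / (ρ / α - 1)) ^ (1 / α) * δ * t ^ (-1 / (p - 1))) ^ α := by
  have hp1 : 0 < p - 1 := by linarith
  have hr : 1 < ρ / α := (one_lt_div hα).2 hαρ
  have hr1 : 0 < ρ / α - 1 := by linarith
  set m := δ * t ^ (-1 / (p - 1)) with hm
  have hm0 : 0 < m := by positivity
  have e0 : ((1 + C₀ / (ρ / α - 1)) ^ (1 / α)) ^ α = 1 + C₀ / (ρ / α - 1) := by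
    rw [← Real.rpow_mul (by positivity), one_div_mul_cancel hα.ne', Real.rpow_one]
  refine (lintegral_mul_ofReal_le_of_weak (k := m ^ α)
    (hG.comp (f := fun y : X => (x, y, t)) (by fun_prop)) (hG1 x t ht)
    (by positivity : 0 ≤ C₀ * t ^ (-θ)) (fun y => hGb x y t ht) hψ
    (by positivity) hr (by positivity) h).trans_eq ?_
  rw [ENNReal.ofReal_rpow_of_nonneg (by positivity) hα.le, mul_assoc _ δ, ← hm,
    Real.mul_rpow (by positivity) hm0.le, e0]
  congr 1
  have e1 : (m ^ α) ^ (1 - ρ / α) = m ^ α * (δ ^ (-ρ) * t ^ θ) := by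
    rw [← Real.rpow_mul hm0.le, show α * (1 - ρ / α) = α + -ρ by field_simp; ring,
      Real.rpow_add hm0]
    congr 1
    rw [hm, Real.mul_rpow hδ.le (by positivity), ← Real.rpow_mul ht.le]
    congr 2
    rw [hρ]
    field_simp
  have e2 : t ^ (-θ) * t ^ θ = 1 := by rw [← Real.rpow_add ht, neg_add_cancel, Real.rpow_zero]
  have e3 : δ ^ ρ * δ ^ (-ρ) = 1 := by rw [← Real.rpow_add hδ, add_neg_cancel, Real.rpow_zero]
  rw [e1]
  calc _ = m ^ α + C₀ / (ρ / α - 1) * m ^ α * (t ^ (-θ) * t ^ θ) * (δ ^ ρ * δ ^ (-ρ)) := by ring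
    _ = _ := by rw [e2, e3]; ring

/-- Global solutions for data small in the critical weak Lebesgue space, with decay. -/
theorem exists_duhamelMap_fixed_of_weak [SFinite μ]
    (hG : Measurable fun q : X × X × ℝ => G q.1 q.2.1 q.2.2) (hGt : ∀ x y t, G x y t ≠ ⊤)
    (hG1x : ∀ y t, 0 < t → ∫⁻ x, G x y t ∂μ = 1)
    (hG1 : ∀ x t, 0 < t → ∫⁻ y, G x y t ∂μ = 1)
    (hK : ∀ x y s t, 0 < s → s < t → G x y t = ∫⁻ ξ, G x ξ (t - s) * G ξ y s ∂μ)
    {C₀ θ : ℝ} (hC₀ : 0 ≤ C₀)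
    (hGb : ∀ x y t, 0 < t → G x y t ≤ ENNReal.ofReal (C₀ * t ^ (-θ)))
    {p ρ : ℝ} (hp : 1 < p) (hρ : ρ = θ * (p - 1)) (hρ1 : 1 < ρ) :
    ∃ δ A D : ℝ, 0 < δ ∧ 0 < A ∧ 0 < D ∧ ∀ φ : X → ℝ, Measurable φ → (∀ x, 0 ≤ φ x) →
      (∀ l : ℝ, 0 < l → μ {x | l < φ x} ≤ ENNReal.ofReal (δ ^ ρ * l ^ (-ρ))) →
      ∀ M : ℝ, 0 ≤ M → (∀ᵐ x ∂μ, φ x ≤ M) →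
      ∃ u : X × ℝ → ℝ≥0∞, Measurable u ∧
        (∀ z, duhamelMap μ G p (fun y => ENNReal.ofReal (φ y)) u z = u z) ∧
        ∀ t, 0 < t → (∀ x, u (x, t) ≤ ENNReal.ofReal (2 * M)) ∧
          (∀ x, u (x, t) ≤ ENNReal.ofReal (A * t ^ (-1 / (p - 1)))) ∧
          ∀ l : ℝ, 0 < l → μ {x | ENNReal.ofReal l < u (x, t)} ≤ ENNReal.ofReal (D * l ^ (-ρ)) := by
  obtain ⟨α, hα, hαmin⟩ := exists_between (lt_min hp hρ1)
  obtain ⟨hαp, hαρ⟩ := lt_min_iff.1 hαmin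
  have hα0 : 0 < α := by linarith
  have hp1 : 0 < p - 1 := by linarith
  have hα1 : 0 < α - 1 := by linarith
  have hr : 1 < ρ / α := (one_lt_div hα0).2 hαρ
  have hr1 : 0 < ρ / α - 1 := by linarith
  set C₁ := (1 + C₀ / (ρ / α - 1)) ^ (1 / α) with hC₁
  have hC₁0 : 0 < C₁ := by positivity
  set A := ((α - 1) / (p - 1) / 2 ^ p) ^ (1 / (p - 1)) with hA
  have hA0 : 0 < A := by positivity
  have hδ : 0 < A / C₁ := by positivity
  have hsmall : 2 ^ p * A ^ (p - 1) * ((p - 1) / (α - 1)) ≤ 1 := by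
    rw [hA, ← Real.rpow_mul (by positivity), one_div_mul_cancel hp1.ne', Real.rpow_one]
    refine le_of_eq ?_
    field_simp
  refine ⟨A / C₁, 2 * A, 2 ^ (ρ / α) / (ρ / α - 1) * (A / C₁) ^ ρ * 2 ^ ρ, hδ, by positivity,
    by positivity, fun φ hφ hφ0 hweak M hM hφM => ?_⟩
  have hψ : Measurable fun y => φ y ^ α := hφ.pow_const α
  have hψweak : ∀ l : ℝ, 0 < l →
      μ {x | l < φ x ^ α} ≤ ENNReal.ofReal ((A / C₁) ^ ρ * l ^ (-(ρ / α))) := fun l hl => by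
    have hset : {x | l < φ x ^ α} ⊆ {x | l ^ (1 / α) < φ x} := fun x hx => by
      simp only [mem_ofPred_eq] at hx ⊢
      rw [one_div]
      exact (Real.rpow_inv_lt_iff_of_pos hl.le (hφ0 x) hα0).2 hx
    refine (measure_mono hset).trans ((hweak _ (by positivity)).trans_eq ?_)
    rw [← Real.rpow_mul hl.le]
    congr 3
    ring
  have hfα : (fun y => ENNReal.ofReal (φ y) ^ α) = fun y => ENNReal.ofReal (φ y ^ α) :=
    funext fun y => ENNReal.ofReal_rpow_of_nonneg (hφ0 y) hα0.le
  set V := kernelFlow μ G (fun y => ENNReal.ofReal (φ y) ^ α) with hVdef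
  have hV : ∀ x t, 0 < t → V (x, t) ≤ ENNReal.ofReal (A * t ^ (-1 / (p - 1))) ^ α :=
    fun x t ht => by
      have := kernelFlow_rpow_le_of_weak hG hG1 hC₀ hGb hp hρ hα0 hαρ hδ hψ hψweak x ht
      rwa [← hfα, ← hVdef, ← hC₁, mul_div_cancel₀ _ hC₁0.ne'] at this
  have hroot : ∀ {v : ℝ≥0∞} {c : ℝ}, v ≤ ENNReal.ofReal c ^ α →
      2 * v ^ (1 / α) ≤ ENNReal.ofReal (2 * c) := fun {v c} hv => by
    rw [ENNReal.ofReal_mul (by norm_num), ENNReal.ofReal_ofNat]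
    gcongr
    refine (ENNReal.rpow_le_rpow hv (by positivity)).trans_eq ?_
    rw [← ENNReal.rpow_mul, mul_one_div_cancel hα0.ne', ENNReal.rpow_one]
  obtain ⟨u, hum, hufix, hule⟩ := exists_duhamelMap_fixed_of_supersolution (μ := μ) (p := p)
    (w := fun z => 2 * V z ^ (1 / α)) (by linarith) hG hφ.ennreal_ofReal
    fun x t ht => duhamelMap_le_of_decay hG hGt hG1 hK hα hαp hA0 hsmall hφ.ennreal_ofReal hV x ht
  refine ⟨u, hum, hufix, fun t ht => ⟨fun x => ?_, fun x => ?_, fun l hl => ?_⟩⟩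
  · refine (hule x t ht).trans (hroot ?_)
    refine kernelFlow_le_of_le hG1 hG (hφM.mono fun y hy => ?_) x ht
    exact ENNReal.rpow_le_rpow (ENNReal.ofReal_le_ofReal hy) hα0.le
  · rw [mul_assoc]
    exact (hule x t ht).trans (hroot (hV x t ht))
  · have hl2 : 0 < l / 2 := by positivity
    have hsub : {x | ENNReal.ofReal l < u (x, t)}
        ⊆ {x | ENNReal.ofReal ((l / 2) ^ α) < V (x, t)} := fun x hx => by
      by_contra hcon
      simp only [mem_ofPred_eq, not_lt] at hx hcon
      rw [← ENNReal.ofReal_rpow_of_nonneg hl2.le hα0.le] at hcon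
      have := (hule x t ht).trans (hroot hcon)
      rw [mul_div_cancel₀ l (two_ne_zero)] at this
      exact absurd hx (not_lt.2 this)
    refine (measure_mono hsub).trans ?_
    rw [hVdef, hfα]
    refine (meas_lintegral_mul_ofReal_le_of_weak (g := fun x y => G x y t)
      (hG.comp (f := fun q : X × X => (q.1, q.2, t)) (by fun_prop)) (fun y => hG1x y t ht)
      (fun x => hG1 x t ht) hψ (by positivity) hr (by positivity) hψweak).trans_eq ?_
    rw [← Real.rpow_mul hl2.le, mul_neg, mul_div_cancel₀ ρ hα0.ne',
      Real.div_rpow hl.le (by norm_num), Real.rpow_neg (by norm_num : (0:ℝ) ≤ 2), div_inv_eq_mul]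
    congr 1
    ring

end Supersolution

section RealKernel

variable {X : Type*} [MeasurableSpace X] {μ : Measure X}

theorem lintegral_ofReal_eq_one_of_integral {g : X → ℝ} (hg : ∀ x, 0 ≤ g x)
    (h : ∫ x, g x ∂μ = 1) : ∫⁻ x, ENNReal.ofReal (g x) ∂μ = 1 := by
  have hi : Integrable g μ := by
    by_contra hcon
    rw [integral_undef hcon] at h
    exact zero_ne_one h
  rw [← ofReal_integral_eq_lintegral_ofReal hi (Filter.Eventually.of_forall hg), h,
    ENNReal.ofReal_one]

/-- A bounded fixed point of the Duhamel map gives a real-valued solution of the integral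
equation. -/
theorem integral_eq_of_duhamelMap_fixed [SFinite μ] {Γ : X → X → ℝ → ℝ}
    (hΓ : Measurable fun q : X × X × ℝ => Γ q.1 q.2.1 q.2.2)
    (hΓ0 : ∀ x y t, 0 < t → 0 ≤ Γ x y t)
    (hG1 : ∀ x t, 0 < t → ∫⁻ y, ENNReal.ofReal (Γ x y t) ∂μ = 1)
    {p : ℝ} (hp : 0 ≤ p) {φ : X → ℝ} (hφ : Measurable φ) (hφ0 : ∀ x, 0 ≤ φ x)
    {u : X × ℝ → ℝ≥0∞} (hu : Measurable u)
    (hfix : ∀ z, duhamelMap μ (fun x y t => ENNReal.ofReal (Γ x y t)) p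
      (fun y => ENNReal.ofReal (φ y)) u z = u z)
    {M : ℝ} (hM : ∀ x t, 0 < t → u (x, t) ≤ ENNReal.ofReal M) (x : X) {t : ℝ} (ht : 0 < t) :
    Integrable (fun y => Γ x y t * φ y) μ ∧
      Integrable (fun q : X × ℝ => Γ x q.1 (t - q.2) * (u (q.1, q.2)).toReal ^ p)
        (μ.prod (volume.restrict (Ioo (0 : ℝ) t))) ∧
      (u (x, t)).toReal = (∫ y, Γ x y t * φ y ∂μ) +
        ∫ s in Ioo (0 : ℝ) t, ∫ y, Γ x y (t - s) * (u (y, s)).toReal ^ p ∂μ := by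
  set G : X → X → ℝ → ℝ≥0∞ := fun x y t => ENNReal.ofReal (Γ x y t) with hGdef
  have hG : Measurable fun q : X × X × ℝ => G q.1 q.2.1 q.2.2 := hΓ.ennreal_ofReal
  have hut : ∀ y s, 0 < s → u (y, s) ≠ ⊤ := fun y s hs =>
    ne_top_of_le_ne_top ENNReal.ofReal_ne_top (hM y s hs)
  have hfirst : ∀ y, ENNReal.ofReal (Γ x y t * φ y) = G x y t * ENNReal.ofReal (φ y) := fun y =>
    ENNReal.ofReal_mul (hΓ0 x y t ht)
  have hsecond : ∀ y, ∀ s ∈ Ioo 0 t,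
      ENNReal.ofReal (Γ x y (t - s) * (u (y, s)).toReal ^ p) = G x y (t - s) * u (y, s) ^ p :=
    fun y s hs => by
      rw [ENNReal.ofReal_mul (hΓ0 x y _ (sub_pos.2 hs.2)),
        ← ENNReal.ofReal_rpow_of_nonneg ENNReal.toReal_nonneg hp,
        ENNReal.ofReal_toReal (hut y s hs.1)]
  have hnn : ∀ y, ∀ s ∈ Ioo 0 t, 0 ≤ Γ x y (t - s) * (u (y, s)).toReal ^ p := fun y s hs =>
    mul_nonneg (hΓ0 x y _ (sub_pos.2 hs.2)) (Real.rpow_nonneg ENNReal.toReal_nonneg _)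
  have hm1 : Measurable fun y => Γ x y t * φ y :=
    (hΓ.comp (f := fun y : X => (x, y, t)) (by fun_prop)).mul hφ
  have hm2 : Measurable fun q : X × ℝ => Γ x q.1 (t - q.2) * (u (q.1, q.2)).toReal ^ p :=
    (hΓ.comp (f := fun q : X × ℝ => (x, q.1, t - q.2)) (by fun_prop)).mul
      (hu.ennreal_toReal.pow_const p)
  have hufix := hfix (x, t)
  have hsum := hut x t ht
  rw [← hufix] at hsum
  obtain ⟨ht1, ht2⟩ := ENNReal.add_ne_top.1 hsum
  have hl2 : ∫⁻ s in Ioo (0 : ℝ) t,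
      ∫⁻ y, ENNReal.ofReal (Γ x y (t - s) * (u (y, s)).toReal ^ p) ∂μ
      = ∫⁻ s in Ioo (0 : ℝ) t, kernelFlow μ G (fun y => u (y, s) ^ p) (x, t - s) :=
    setLIntegral_congr_fun measurableSet_Ioo fun s hs => lintegral_congr fun y => hsecond y s hs
  have hI1 : Integrable (fun y => Γ x y t * φ y) μ := by
    refine (lintegral_ofReal_ne_top_iff_integrable hm1.aestronglyMeasurable
      (Filter.Eventually.of_forall fun y => mul_nonneg (hΓ0 x y t ht) (hφ0 y))).1 ?_
    simp_rw [hfirst]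
    exact ht1
  have hae : ∀ᵐ q : X × ℝ ∂(μ.prod (volume.restrict (Ioo (0 : ℝ) t))), q.2 ∈ Ioo 0 t :=
    Measure.quasiMeasurePreserving_snd.ae (ae_restrict_mem measurableSet_Ioo)
  have hI2 : Integrable (fun q : X × ℝ => Γ x q.1 (t - q.2) * (u (q.1, q.2)).toReal ^ p)
      (μ.prod (volume.restrict (Ioo (0 : ℝ) t))) := by
    refine (lintegral_ofReal_ne_top_iff_integrable hm2.aestronglyMeasurable
      (hae.mono fun q hq => hnn q.1 q.2 hq)).1 ?_
    rw [lintegral_prod_symm' _ hm2.ennreal_ofReal, hl2]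
    exact ht2
  refine ⟨hI1, hI2, ?_⟩
  have hE1 : ∫ y, Γ x y t * φ y ∂μ
      = (kernelFlow μ G (fun y => ENNReal.ofReal (φ y)) (x, t)).toReal := by
    rw [integral_eq_lintegral_of_nonneg_ae
      (Filter.Eventually.of_forall fun y => mul_nonneg (hΓ0 x y t ht) (hφ0 y))
      hm1.aestronglyMeasurable]
    simp_rw [hfirst]
    rfl
  have hE2 : ∫ s in Ioo (0 : ℝ) t, ∫ y, Γ x y (t - s) * (u (y, s)).toReal ^ p ∂μ
      = (∫⁻ s in Ioo (0 : ℝ) t, kernelFlow μ G (fun y => u (y, s) ^ p) (x, t - s)).toReal := by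
    rw [← integral_toReal]
    · refine setIntegral_congr_fun measurableSet_Ioo fun s hs => ?_
      rw [integral_eq_lintegral_of_nonneg_ae (Filter.Eventually.of_forall fun y => hnn y s hs)
        (hm2.comp (by fun_prop : Measurable fun y : X => (y, s))).aestronglyMeasurable]
      congr 1
      exact lintegral_congr fun y => hsecond y s hs
    · exact ((measurable_kernelFlow_source (p := p) (μ := μ) hG hu).comp
        (by fun_prop : Measurable fun s : ℝ => ((x, t), s))).aemeasurable
    · refine (ae_restrict_iff' measurableSet_Ioo).2 (Filter.Eventually.of_forall fun s hs => ?_)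
      have hle := kernelFlow_le_of_le (f := fun y => u (y, s) ^ p) hG1 hG
        (Filter.Eventually.of_forall fun y => ENNReal.rpow_le_rpow (hM y s hs.1) hp) x
        (sub_pos.2 hs.2)
      exact hle.trans_lt (ENNReal.rpow_lt_top_of_nonneg hp ENNReal.ofReal_ne_top)
  rw [hE1, hE2, ← ENNReal.toReal_add ht1 ht2, ← hufix]
  rfl

end RealKernel

theorem meas_lt_le_of_weakNorm_le {N : ℕ} {r δ : ℝ} (hr : 0 < r) (hδ : 0 ≤ δ) {f : E N → ℝ}
    (h : weakNorm N r f ≤ ENNReal.ofReal δ) {l : ℝ} (hl : 0 < l) :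
    volume {x | l < |f x|} ≤ ENNReal.ofReal (δ ^ r * l ^ (-r)) := by
  have h1 : ENNReal.ofReal l * volume {x | l < |f x|} ^ (1 / r) ≤ ENNReal.ofReal δ :=
    (le_iSup₂ (f := fun (l : ℝ) (_ : 0 < l) =>
      ENNReal.ofReal l * volume {x : E N | l < |f x|} ^ (1 / r)) l hl).trans h
  have h2 : volume {x | l < |f x|} ^ (1 / r) ≤ ENNReal.ofReal (δ / l) := by
    rw [ENNReal.ofReal_div_of_pos hl, ENNReal.le_div_iff_mul_le (Or.inl (by simpa using hl))
      (Or.inl ENNReal.ofReal_ne_top), mul_comm]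
    exact h1
  have h3 := ENNReal.rpow_le_rpow h2 hr.le
  rwa [← ENNReal.rpow_mul, one_div_mul_cancel hr.ne', ENNReal.rpow_one,
    ENNReal.ofReal_rpow_of_nonneg (by positivity) hr.le, Real.div_rpow hδ hl.le,
    div_eq_mul_inv, ← Real.rpow_neg hl.le] at h3

/-- Interpolation between weak `L^r` and `L^∞`. -/
theorem weakNorm_le_of_weak_of_bounded {N : ℕ} {r q D L : ℝ} (hr : 0 < r) (hrq : r ≤ q)
    (hD : 0 ≤ D) {f : E N → ℝ} (hL : ∀ x, |f x| ≤ L)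
    (h : ∀ l : ℝ, 0 < l → volume {x | l < |f x|} ≤ ENNReal.ofReal (D * l ^ (-r))) :
    weakNorm N q f ≤ ENNReal.ofReal (D ^ (1 / q) * L ^ (1 - r / q)) := by
  have hq : 0 < q := hr.trans_le hrq
  refine iSup₂_le fun l hl => ?_
  rcases le_or_gt L l with hLl | hLl
  · have hempty : {x | l < |f x|} = ∅ := by
      ext x
      simpa using (hL x).trans hLl
    rw [hempty, measure_empty, ENNReal.zero_rpow_of_pos (by positivity), mul_zero]
    exact zero_le
  · calc _ ≤ ENNReal.ofReal l * ENNReal.ofReal (D * l ^ (-r)) ^ (1 / q) := by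
          gcongr
          exact h l hl
      _ = ENNReal.ofReal (D ^ (1 / q) * l ^ (1 - r / q)) := by
          rw [ENNReal.ofReal_rpow_of_nonneg (by positivity) (by positivity),
            ← ENNReal.ofReal_mul hl.le, Real.mul_rpow hD (by positivity), ← Real.rpow_mul hl.le,
            Real.rpow_sub hl, Real.rpow_one, show -r * (1 / q) = -(r / q) by ring,
            Real.rpow_neg hl.le]
          congr 1
          ring
      _ ≤ _ := by
          have : r / q ≤ 1 := (div_le_one hq).2 hrq
          gcongr

/-- A function bounded near zero and decaying like `t^{-e}` decays like `(1 + t)^{-e}`. -/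
theorem min_le_mul_one_add_rpow {M A e t : ℝ} (hM : 0 ≤ M) (hA : 0 ≤ A) (he : 0 ≤ e)
    (ht : 0 < t) : min M (A * t ^ (-e)) ≤ (M + A) * 2 ^ e * (1 + t) ^ (-e) := by
  have h2 : (2 : ℝ) ^ e * 2 ^ (-e) = 1 := by
    rw [← Real.rpow_add two_pos, add_neg_cancel, Real.rpow_zero]
  rcases le_total t 1 with h | h
  · have h1 : (2 : ℝ) ^ (-e) ≤ (1 + t) ^ (-e) :=
      Real.rpow_le_rpow_of_nonpos (by linarith) (by linarith) (by linarith)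
    calc min M (A * t ^ (-e)) ≤ M + A := (min_le_left _ _).trans (by linarith)
      _ = (M + A) * 2 ^ e * 2 ^ (-e) := by rw [mul_assoc, h2, mul_one]
      _ ≤ _ := by gcongr
  · have h1 : (2 * t) ^ (-e) ≤ (1 + t) ^ (-e) :=
      Real.rpow_le_rpow_of_nonpos (by linarith) (by linarith) (by linarith)
    calc min M (A * t ^ (-e)) ≤ A * t ^ (-e) := min_le_right _ _
      _ ≤ (M + A) * t ^ (-e) := by gcongr; linarith
      _ = (M + A) * 2 ^ e * (2 * t) ^ (-e) := by
          rw [Real.mul_rpow two_pos.le ht.le]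
          linear_combination (-(M + A) * t ^ (-e)) * h2
      _ ≤ _ := by gcongr

/-- Theorem 1.3(i): global existence for small data in weak `L^{r_*}`, for any
nonnegative kernel satisfying (K1), (K2) and the upper Gaussian-type bound,
with the decay estimate in weak `L^q` norms for `r_* ≤ q ≤ ∞`. -/
theorem global_existence_weakLp_line_weight
    (N : ℕ) (hN : 1 ≤ N) (a : ℝ) (ha1 : -1 < a) (ha2 : a < 1) (haN : a * N < 2)
    (p : ℝ) (hp : 1 + (2 - a) / N < p)
    (rs : ℝ) (hrs : rs = N * (p - 1) / (2 - a))
    (Γ : E N → E N → ℝ → ℝ)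
    (hΓmeas : Measurable (fun q : E N × E N × ℝ => Γ q.1 q.2.1 q.2.2))
    (hΓnonneg : ∀ x y : E N, ∀ t : ℝ, 0 < t → 0 ≤ Γ x y t)
    (hK1x : ∀ y : E N, ∀ t : ℝ, 0 < t → ∫ x : E N, Γ x y t = 1)
    (hK1y : ∀ x : E N, ∀ t : ℝ, 0 < t → ∫ y : E N, Γ x y t = 1)
    (hK2 : ∀ x y : E N, ∀ s t : ℝ, 0 < s → s < t →
      Γ x y t = ∫ ξ : E N, Γ x ξ (t - s) * Γ ξ y s)
    (hupp : ∃ C₀ c₀ : ℝ, 0 < C₀ ∧ 0 < c₀ ∧ ∀ x y : E N, ∀ t : ℝ, 0 < t →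
      Γ x y t ≤ C₀ * t ^ (-(N : ℝ) / (2 - a)) *
        Real.exp (-c₀ * (‖x - y‖ ^ (2 - a) / t) ^ (1 / (1 - a)))) :
    ∃ δ : ℝ, 0 < δ ∧ ∀ φ : E N → ℝ, Measurable φ → (∀ x, 0 ≤ φ x) →
      eLpNorm φ ⊤ volume ≠ ⊤ → weakNorm N rs φ < ENNReal.ofReal δ →
      ∃ u : E N → ℝ → ℝ, IsMildSolution N p Γ φ ⊤ u ∧
        (∀ q : ℝ, rs ≤ q → ∃ C : ℝ≥0∞, C ≠ ⊤ ∧ ∀ t : ℝ, 0 < t →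
          ENNReal.ofReal ((1 + t) ^ ((N : ℝ) / (2 - a) * (1 / rs - 1 / q))) *
            weakNorm N q (fun x => u x t) ≤ C) ∧
        (∃ C : ℝ≥0∞, C ≠ ⊤ ∧ ∀ t : ℝ, 0 < t →
          ENNReal.ofReal ((1 + t) ^ ((N : ℝ) / (2 - a) * (1 / rs))) *
            eLpNorm (fun x => u x t) ⊤ volume ≤ C) := by
  obtain ⟨C₀, c₀, hC₀, hc₀, hΓle⟩ := hupp
  have hN0 : (0 : ℝ) < N := by exact_mod_cast hN
  have h2a : 0 < 2 - a := by linarith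
  have hθ0 : 0 < (N : ℝ) / (2 - a) := by positivity
  have hp1 : 1 < p := lt_trans (by linarith [div_pos h2a hN0]) hp
  have hp0 : 0 < p - 1 := by linarith
  have hrsθ : rs = (N : ℝ) / (2 - a) * (p - 1) := by rw [hrs]; ring
  have hrs1 : 1 < rs := by
    rw [hrs, one_lt_div h2a]
    have : (2 - a) / N < p - 1 := by linarith
    rwa [div_lt_iff₀ hN0, mul_comm] at this
  have hrs0 : 0 < rs := by linarith
  have hθrs : (N : ℝ) / (2 - a) * (1 / rs) = 1 / (p - 1) := by
    rw [hrsθ]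
    field_simp
  have hΓb : ∀ x y t, 0 < t → Γ x y t ≤ C₀ * t ^ (-((N : ℝ) / (2 - a))) := fun x y t ht => by
    refine (hΓle x y t ht).trans ?_
    rw [neg_div]
    refine mul_le_of_le_one_right (by positivity) (Real.exp_le_one_iff.2 ?_)
    have : 0 ≤ (‖x - y‖ ^ (2 - a) / t) ^ (1 / (1 - a)) := by positivity
    nlinarith
  have hG1x : ∀ y t, 0 < t → ∫⁻ x, ENNReal.ofReal (Γ x y t) = 1 := fun y t ht =>
    lintegral_ofReal_eq_one_of_integral (fun x => hΓnonneg x y t ht) (hK1x y t ht)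
  have hG1 : ∀ x t, 0 < t → ∫⁻ y, ENNReal.ofReal (Γ x y t) = 1 := fun x t ht =>
    lintegral_ofReal_eq_one_of_integral (fun y => hΓnonneg x y t ht) (hK1y x t ht)
  have hK : ∀ x y s t, 0 < s → s < t → ENNReal.ofReal (Γ x y t)
      = ∫⁻ ξ, ENNReal.ofReal (Γ x ξ (t - s)) * ENNReal.ofReal (Γ ξ y s) := by
    intro x y s t hs hst
    have hts : 0 < t - s := sub_pos.2 hst
    have hm : Measurable fun ξ => Γ x ξ (t - s) * Γ ξ y s :=
      (hΓmeas.comp (f := fun ξ : E N => (x, ξ, t - s)) (by fun_prop)).mul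
        (hΓmeas.comp (f := fun ξ : E N => (ξ, y, s)) (by fun_prop))
    have hi : Integrable fun ξ => Γ x ξ (t - s) := by
      by_contra hcon
      exact zero_ne_one ((integral_undef hcon).symm.trans (hK1y x _ hts))
    have hprod : Integrable fun ξ => Γ x ξ (t - s) * Γ ξ y s := by
      refine (hi.mul_const (C₀ * s ^ (-((N : ℝ) / (2 - a))))).mono' hm.aestronglyMeasurable
        (Filter.Eventually.of_forall fun ξ => ?_)
      rw [Real.norm_of_nonneg (mul_nonneg (hΓnonneg _ _ _ hts) (hΓnonneg _ _ _ hs))]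
      exact mul_le_mul_of_nonneg_left (hΓb _ _ _ hs) (hΓnonneg _ _ _ hts)
    rw [hK2 x y s t hs hst, ofReal_integral_eq_lintegral_ofReal hprod
      (Filter.Eventually.of_forall fun ξ =>
        mul_nonneg (hΓnonneg _ _ _ hts) (hΓnonneg _ _ _ hs))]
    exact lintegral_congr fun ξ => ENNReal.ofReal_mul (hΓnonneg _ _ _ hts)
  obtain ⟨δ, A, D, hδ, hA, hD, hmain⟩ := exists_duhamelMap_fixed_of_weak (μ := volume)
    (G := fun x y t => ENNReal.ofReal (Γ x y t)) hΓmeas.ennreal_ofReal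
    (fun _ _ _ => ENNReal.ofReal_ne_top) hG1x hG1 hK hC₀.le
    (fun x y t ht => ENNReal.ofReal_le_ofReal (hΓb x y t ht)) hp1 hrsθ hrs1
  refine ⟨δ, hδ, fun φ hφ hφ0 hφt hφw => ?_⟩
  set M := (eLpNorm φ ⊤ volume).toReal with hMdef
  have hM : 0 ≤ M := ENNReal.toReal_nonneg
  have hφM : ∀ᵐ x : E N, φ x ≤ M := by
    filter_upwards [enorm_ae_le_eLpNormEssSup φ volume] with x hx
    rw [← eLpNorm_exponent_top] at hx
    rwa [Real.enorm_eq_ofReal (hφ0 x), ENNReal.ofReal_le_iff_le_toReal hφt] at hx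
  have hweak : ∀ l : ℝ, 0 < l → volume {x | l < φ x} ≤ ENNReal.ofReal (δ ^ rs * l ^ (-rs)) :=
    fun l hl => by
      have := meas_lt_le_of_weakNorm_le hrs0 hδ.le hφw.le hl
      simpa only [abs_of_nonneg (hφ0 _)] using this
  obtain ⟨u, hum, hufix, hub⟩ := hmain φ hφ hφ0 hweak M hM hφM
  have hsol := fun x t => integral_eq_of_duhamelMap_fixed (x := x) (t := t) hΓmeas hΓnonneg hG1
    (by linarith : 0 ≤ p) hφ hφ0 hum hufix (fun x t ht => (hub t ht).1 x)
  set L := (2 * M + A) * 2 ^ (1 / (p - 1)) with hLdef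
  have hL0 : 0 < L := by positivity
  have hdecay : ∀ x t, 0 < t → |(u (x, t)).toReal| ≤ L * (1 + t) ^ (-(1 / (p - 1))) :=
    fun x t ht => by
      rw [abs_of_nonneg ENNReal.toReal_nonneg]
      refine le_trans (le_min (ENNReal.toReal_le_of_le_ofReal (by positivity) ((hub t ht).1 x)) ?_)
        (min_le_mul_one_add_rpow (A := A) (e := 1 / (p - 1)) (by positivity) hA.le
          (by positivity) ht)
      rw [← neg_div]
      exact ENNReal.toReal_le_of_le_ofReal (by positivity) ((hub t ht).2.1 x)
  have huweak : ∀ t, 0 < t → ∀ l : ℝ, 0 < l →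
      volume {x | l < |(u (x, t)).toReal|} ≤ ENNReal.ofReal (D * l ^ (-rs)) :=
    fun t ht l hl => by
      refine (measure_mono fun x hx => ?_).trans ((hub t ht).2.2 l hl)
      simp only [mem_ofPred_eq, abs_of_nonneg ENNReal.toReal_nonneg] at hx ⊢
      exact (ENNReal.ofReal_lt_iff_lt_toReal hl.le
        (ne_top_of_le_ne_top ENNReal.ofReal_ne_top ((hub t ht).1 x))).2 hx
  refine ⟨fun x t => (u (x, t)).toReal, ⟨hum.ennreal_toReal, fun x t => ENNReal.toReal_nonneg,
    ⟨2 * M, fun t ht _ => Filter.Eventually.of_forall fun x =>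
      ENNReal.toReal_le_of_le_ofReal (by positivity) ((hub t ht).1 x)⟩,
    fun t ht _ => Filter.Eventually.of_forall fun x => hsol x t ht⟩,
    fun q hq => ⟨ENNReal.ofReal (D ^ (1 / q) * L ^ (1 - rs / q)), ENNReal.ofReal_ne_top,
      fun t ht => ?_⟩,
    ⟨ENNReal.ofReal L, ENNReal.ofReal_ne_top, fun t ht => ?_⟩⟩
  · have hq0 : 0 < q := hrs0.trans_le hq
    have h1t : 0 < 1 + t := by linarith
    refine (mul_le_mul_right (weakNorm_le_of_weak_of_bounded hrs0 hq hD.le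
      (fun x => hdecay x t ht) (huweak t ht)) _).trans_eq ?_
    rw [← ENNReal.ofReal_mul (by positivity), Real.mul_rpow hL0.le (by positivity),
      ← Real.rpow_mul h1t.le]
    have hexp : (N : ℝ) / (2 - a) * (1 / rs - 1 / q) = 1 / (p - 1) * (1 - rs / q) := by
      rw [← hθrs]
      field_simp
    have hone : (1 + t) ^ (1 / (p - 1) * (1 - rs / q))
        * (1 + t) ^ (-(1 / (p - 1)) * (1 - rs / q)) = 1 := by
      rw [← Real.rpow_add h1t, neg_mul, add_neg_cancel, Real.rpow_zero]
    rw [hexp]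
    congr 1
    linear_combination (D ^ (1 / q) * L ^ (1 - rs / q)) * hone
  · have h1t : 0 < 1 + t := by linarith
    have hsup : eLpNorm (fun x => (u (x, t)).toReal) ⊤ volume
        ≤ ENNReal.ofReal (L * (1 + t) ^ (-(1 / (p - 1)))) := by
      rw [eLpNorm_exponent_top]
      exact eLpNormEssSup_le_of_ae_bound (Filter.Eventually.of_forall fun x => hdecay x t ht)
    refine (mul_le_mul_right hsup _).trans_eq ?_
    rw [← ENNReal.ofReal_mul (by positivity), hθrs]
    have hone : (1 + t) ^ (1 / (p - 1)) * (1 + t) ^ (-(1 / (p - 1))) = 1 := by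
      rw [← Real.rpow_add h1t, add_neg_cancel, Real.rpow_zero]
    congr 1
    linear_combination L * hone
end
end
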